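/- A Riemannian product space 𝕄ⁿ × I admits a totally umbilical hypersurface Σ which is neither vertical nor horizontal at some point (p,t) ∈ 𝕄ⁿ × I if and only if 𝕄ⁿ has, in a neighborhood of p, the structure of a warped product of an interval of the Euclidean line with some (n−1)-dimensional Riemannian manifold. -/

import Mathlib

noncomputable section
open Real Set

/-- Points of the coordinate chart `ℝⁿ`. -/
abbrev Pt (n : ℕ) := Fin n → ℝ

/-- The `i`-th standard coordinate vector. -/
def stdb (n : ℕ) (i : Fin n) : Pt n := Pi.single i 1

/-- Riemannian metric data in coordinates: a field of symmetric bilinear forms. -/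
abbrev Met (n : ℕ) := Pt n → Fin n → Fin n → ℝ

/-- The inner product of the vectors `v`, `w` at the point `x`, with respect to `g`. -/
def minner {n : ℕ} (g : Met n) (x v w : Pt n) : ℝ := ∑ i, ∑ j, g x i j * v i * w j

/-- `g` is a smooth Riemannian metric on `U`. -/
def IsMetricOn {n : ℕ} (U : Set (Pt n)) (g : Met n) : Prop :=
  (∀ i j, ContDiffOn ℝ (⊤ : ℕ∞) (fun x => g x i j) U) ∧
  (∀ x i j, g x i j = g x j i) ∧
  (∀ x ∈ U, ∀ v : Pt n, v ≠ 0 → 0 < minner g x v v)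

/-- The inverse metric `g^{kl}`. -/
def ginv {n : ℕ} (g : Met n) (x : Pt n) : Fin n → Fin n → ℝ :=
  fun k l => (Matrix.of (g x))⁻¹ k l

/-- The Christoffel symbols `Γᵏᵢⱼ` of the Levi-Civita connection of `g`. -/
def christoffel {n : ℕ} (g : Met n) (x : Pt n) (k i j : Fin n) : ℝ :=
  (1/2) * ∑ l, ginv g x k l *
    (fderiv ℝ (fun y => g y j l) x (stdb n i) + fderiv ℝ (fun y => g y i l) x (stdb n j)
      - fderiv ℝ (fun y => g y i j) x (stdb n l))

/-- The covariant derivative (Levi-Civita connection of `g`) of the vector field `Y`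
at the point `x` in the direction `v`. -/
def covD {n : ℕ} (g : Met n) (Y : Pt n → Pt n) (x v : Pt n) : Pt n :=
  fun k => fderiv ℝ (fun y => Y y k) x v + ∑ i, ∑ j, christoffel g x k i j * v i * Y x j

/-- `X` is a Killing field of `g` on `U`. -/
def IsKillingOn {n : ℕ} (U : Set (Pt n)) (g : Met n) (X : Pt n → Pt n) : Prop :=
  ∀ x ∈ U, ∀ v w : Pt n,
    minner g x (covD g X x v) w + minner g x (covD g X x w) v = 0

/-- `X` has unit length on `U`. -/
def IsUnitOn {n : ℕ} (U : Set (Pt n)) (g : Met n) (X : Pt n → Pt n) : Prop :=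
  ∀ x ∈ U, minner g x (X x) (X x) = 1

/-- The Lie bracket `[X,Y]` of two vector fields, in coordinates. -/
def lieB {n : ℕ} (X Y : Pt n → Pt n) (x : Pt n) : Pt n :=
  fun k => fderiv ℝ (fun y => Y y k) x (X x) - fderiv ℝ (fun y => X y k) x (Y x)

/-- A parametrized hypersurface `F : V → ℝ^{n+1}` with a chosen unit normal field `N`. -/
structure Hyp (n : ℕ) where
  V : Set (Pt n)
  F : Pt n → Pt (n+1)
  N : Pt n → Pt (n+1)

/-- The ambient covariant derivative, along the map `F`, of the ambient-vector-valued
field `W` defined on the parameter domain, in the coordinate direction `v`. -/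
def covAlong {n : ℕ} (g : Met (n+1)) (F W : Pt n → Pt (n+1)) (u v : Pt n) : Pt (n+1) :=
  fun k => fderiv ℝ (fun y => W y k) u v +
    ∑ i, ∑ j, christoffel g (F u) k i j * fderiv ℝ F u v i * W u j

/-- `S` is a smooth immersed hypersurface inside the chart `U`, with unit normal `N`. -/
def Hyp.IsRegular {n : ℕ} (S : Hyp n) (U : Set (Pt (n+1))) (g : Met (n+1)) : Prop :=
  IsOpen S.V ∧ ContDiffOn ℝ (⊤ : ℕ∞) S.F S.V ∧ (∀ u ∈ S.V, S.F u ∈ U) ∧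
  (∀ u ∈ S.V, LinearIndependent ℝ (fun a : Fin n => fderiv ℝ S.F u (stdb n a))) ∧
  ContDiffOn ℝ (⊤ : ℕ∞) S.N S.V ∧
  (∀ u ∈ S.V, minner g (S.F u) (S.N u) (S.N u) = 1) ∧
  (∀ u ∈ S.V, ∀ a : Fin n, minner g (S.F u) (S.N u) (fderiv ℝ S.F u (stdb n a)) = 0)

/-- `S` is totally geodesic: the shape operator `X ↦ -∇̃_X N` vanishes. -/
def Hyp.TotallyGeodesic {n : ℕ} (S : Hyp n) (g : Met (n+1)) : Prop :=
  ∀ u ∈ S.V, ∀ a : Fin n, covAlong g S.F S.N u (stdb n a) = 0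

/-- `S` is totally umbilical: the shape operator `X ↦ -∇̃_X N` is pointwise a
multiple of the identity. -/
def Hyp.TotallyUmbilical {n : ℕ} (S : Hyp n) (g : Met (n+1)) : Prop :=
  ∃ lam : Pt n → ℝ, ∀ u ∈ S.V, ∀ a : Fin n,
    covAlong g S.F S.N u (stdb n a) = lam u • fderiv ℝ S.F u (stdb n a)

/-- Projection onto the first `n` coordinates. -/
def projBase {n : ℕ} (x : Pt (n+1)) : Pt n := fun i => x i.castSucc

/-- The product metric of `g₀` with the Euclidean line (last coordinate). -/
def prodMet {n : ℕ} (g₀ : Met n) : Met (n+1) := fun x i j =>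
  Fin.lastCases (Fin.lastCases 1 (fun _ => 0) j)
    (fun i' => Fin.lastCases 0 (fun j' => g₀ (projBase x) i' j') j) i

/-- The coordinate domain of a product `𝕄 × I`. -/
def prodDom {n : ℕ} (U₀ : Set (Pt n)) (I : Set ℝ) : Set (Pt (n+1)) :=
  {x | projBase x ∈ U₀ ∧ x (Fin.last n) ∈ I}

/-- The unit vertical field `ξ` of a product `𝕄 × I`. -/
def vert (n : ℕ) : Pt (n+1) → Pt (n+1) := fun _ => stdb (n+1) (Fin.last n)

/-- The pullback of the metric `g` under the map `Φ`. -/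
def pullMet {n : ℕ} (g : Met n) (Φ : Pt n → Pt n) : Met n :=
  fun x i j => minner g (Φ x) (fderiv ℝ Φ x (stdb n i)) (fderiv ℝ Φ x (stdb n j))

/-- `g` has, on the coordinate domain `W`, the shape `dt² + f(t)² g_M` of a warped
product of an interval (the `0`-th coordinate) with an `n`-dimensional manifold. -/
def IsWarpedForm {n : ℕ} (g : Met (n+1)) (W : Set (Pt (n+1))) : Prop :=
  ∃ f : ℝ → ℝ, ContDiff ℝ (⊤ : ℕ∞) f ∧ (∀ t, 0 < f t) ∧
    ∀ x ∈ W, g x 0 0 = 1 ∧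
      (∀ i : Fin (n+1), i ≠ 0 → g x 0 i = 0 ∧ g x i 0 = 0) ∧
      (∀ i j : Fin (n+1), i ≠ 0 → j ≠ 0 →
        fderiv ℝ (fun y => g y i j / f (y 0) ^ 2) x (stdb (n+1) 0) = 0)

/-- The Riemannian manifold `(U₀, g₀)` has, in a neighborhood of `p`, the structure of a
warped product of an interval of the Euclidean line with an `n`-dimensional manifold:
there is a diffeomorphism `Φ` from a coordinate domain `W` onto a neighborhood of `p`
pulling `g₀` back to a warped-product metric. -/
def LocallyWarpedAt {n : ℕ} (U₀ : Set (Pt (n+1))) (g₀ : Met (n+1)) (p : Pt (n+1)) : Prop :=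
  ∃ (W : Set (Pt (n+1))) (Φ Ψ : Pt (n+1) → Pt (n+1)),
    IsOpen W ∧ ContDiffOn ℝ (⊤ : ℕ∞) Φ W ∧ MapsTo Φ W U₀ ∧
    IsOpen (Φ '' W) ∧ p ∈ Φ '' W ∧
    ContDiffOn ℝ (⊤ : ℕ∞) Ψ (Φ '' W) ∧ (∀ w ∈ W, Ψ (Φ w) = w) ∧
    IsWarpedForm (pullMet g₀ Φ) W

/-- The Levi-Civita symbol on three indices. -/
def lcSymb (i j k : Fin 3) : ℝ :=
  ((j.val : ℝ) - (i.val : ℝ)) * ((k.val : ℝ) - (i.val : ℝ)) * ((k.val : ℝ) - (j.val : ℝ)) / 2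

/-- The cross product of `v` and `w` at `x`, with respect to the metric `g` and the
orientation of the chart. -/
def crossG (g : Met 3) (x v w : Pt 3) : Pt 3 :=
  fun k => Real.sqrt (Matrix.det (Matrix.of (g x))) *
    ∑ l, ginv g x k l * ∑ i, ∑ j, lcSymb l i j * v i * w j

/-- The components `Rˡᵢⱼₖ` of the Riemann curvature tensor
(`R(∂ᵢ,∂ⱼ)∂ₖ = Rˡᵢⱼₖ ∂ₗ`, with `R(X,Y) = ∇_X∇_Y - ∇_Y∇_X - ∇_{[X,Y]}`). -/
def riem {n : ℕ} (g : Met n) (x : Pt n) (l i j k : Fin n) : ℝ :=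
  fderiv ℝ (fun y => christoffel g y l j k) x (stdb n i)
  - fderiv ℝ (fun y => christoffel g y l i k) x (stdb n j)
  + ∑ m, (christoffel g x l i m * christoffel g x m j k
      - christoffel g x l j m * christoffel g x m i k)

/-- The curvature operator `R(v,w)z` at `x`. -/
def riemVec {n : ℕ} (g : Met n) (x v w z : Pt n) : Pt n :=
  fun l => ∑ i, ∑ j, ∑ k, riem g x l i j k * v i * w j * z k

/-- `g` has constant sectional curvature `c` on `W`. -/
def HasConstCurv {n : ℕ} (W : Set (Pt n)) (g : Met n) (c : ℝ) : Prop :=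
  ∀ x ∈ W, ∀ v w : Pt n,
    minner g x (riemVec g x v w w) v
      = c * (minner g x v v * minner g x w w - (minner g x v w) ^ 2)

/-- The Ricci tensor of `g`. -/
def ricci {n : ℕ} (g : Met n) (x : Pt n) (j k : Fin n) : ℝ := ∑ i, riem g x i i j k

/-- The scalar curvature of `g`. -/
def scal {n : ℕ} (g : Met n) (x : Pt n) : ℝ := ∑ j, ∑ k, ginv g x j k * ricci g x j k

/-- The metric `dx² + sin²θ(x) dy² + cos²θ(x) dz²` on a three-dimensional chart. -/
def tgMet (θ : ℝ → ℝ) : Met 3 := fun x i j =>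
  if i = j then
    (if i = 0 then 1 else if i = 1 then (Real.sin (θ (x 0))) ^ 2 else (Real.cos (θ (x 0))) ^ 2)
  else 0

/-- The warped product metric `dt² + f(t)² g₀` (interval coordinate first). -/
def warpMet {n : ℕ} (f : ℝ → ℝ) (g₀ : Met n) : Met (n+1) := fun x i j =>
  Fin.cases (Fin.cases 1 (fun _ => 0) j)
    (fun i' => Fin.cases 0 (fun j' => f (x 0) ^ 2 * g₀ (Fin.tail x) i' j') j) i

/-- The coordinate domain of a warped product `I ×_f 𝕄` (interval coordinate first). -/
def warpDom {n : ℕ} (I : Set ℝ) (U₀ : Set (Pt n)) : Set (Pt (n+1)) :=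
  {x | x 0 ∈ I ∧ Fin.tail x ∈ U₀}

/-- The covariant acceleration of a curve `γ`, whose vanishing defines geodesics. -/
def curveAccel {n : ℕ} (g : Met n) (γ : ℝ → Pt n) (s : ℝ) : Pt n :=
  fun k => deriv (fun t => deriv (fun r => γ r k) t) s +
    ∑ i, ∑ j, christoffel g (γ s) k i j * deriv (fun r => γ r i) s * deriv (fun r => γ r j) s

/-- The velocity of a curve. -/
def vel {n : ℕ} (γ : ℝ → Pt n) (s : ℝ) : Pt n := fun k => deriv (fun r => γ r k) s

section

open scoped ContDiff Topology

/-- A smooth map on an open subset of a finite-dimensional space agrees near each point with a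
globally smooth map. -/
theorem exists_contDiff_eventuallyEq {E F : Type} [NormedAddCommGroup E] [NormedSpace ℝ E]
    [FiniteDimensional ℝ E] [NormedAddCommGroup F] [NormedSpace ℝ F] {f : E → F} {O : Set E}
    (hO : IsOpen O) (hf : ContDiffOn ℝ ∞ f O) {p : E} (hp : p ∈ O) :
    ∃ h : E → F, ContDiff ℝ ∞ h ∧ h =ᶠ[𝓝 p] f := by
  obtain ⟨r, hr, hrO⟩ := Metric.isOpen_iff.1 hO p hp
  let b : ContDiffBump p := ⟨r / 3, r / 2, by positivity, by linarith⟩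
  refine ⟨fun x => b x • f x, ?_, ?_⟩
  · rw [contDiff_iff_contDiffAt]
    intro x
    by_cases hx : x ∈ O
    · exact b.contDiff.contDiffAt.smul (hf.contDiffAt (hO.mem_nhds hx))
    · have hx' : x ∈ (tsupport b)ᶜ := by
        rw [b.tsupport_eq]
        intro h
        exact hx (hrO (Metric.closedBall_subset_ball (by simp [b]; linarith) h))
      have : (fun x => b x • f x) =ᶠ[𝓝 x] fun _ => 0 := by
        filter_upwards [(isClosed_tsupport b).isOpen_compl.mem_nhds hx'] with y hy
        rw [image_eq_zero_of_notMem_tsupport hy, zero_smul]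
      exact contDiffAt_const.congr_of_eventuallyEq this
  · filter_upwards [b.eventuallyEq_one] with y hy
    simp [hy]

/-- Inverse function theorem: near a point where the derivative is invertible, a smooth map is a
diffeomorphism of a ball onto an open set. -/
theorem exists_ball_smooth_leftInverse {E F : Type} [NormedAddCommGroup E] [NormedSpace ℝ E]
    [CompleteSpace E] [NormedAddCommGroup F] [NormedSpace ℝ F] [CompleteSpace F] {f : E → F}
    {O : Set E} (hO : IsOpen O) (hf : ContDiffOn ℝ ∞ f O) {a : E} (ha : a ∈ O) {f' : E ≃L[ℝ] F}
    (hf' : HasFDerivAt f (f' : E →L[ℝ] F) a) :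
    ∃ r > 0, Metric.ball a r ⊆ O ∧ IsOpen (f '' Metric.ball a r) ∧
      ∃ Ψ : F → E, ContDiffOn ℝ ∞ Ψ (f '' Metric.ball a r) ∧
        ∀ w ∈ Metric.ball a r, Ψ (f w) = w := by
  have hfa : ContDiffAt ℝ ∞ f a := hf.contDiffAt (hO.mem_nhds ha)
  let e := hfa.toOpenPartialHomeomorph f hf' (by simp)
  have hes : a ∈ e.source := hfa.mem_toOpenPartialHomeomorph_source hf' (by simp)
  have hinv : ∀ᶠ x in 𝓝 a, fderiv ℝ f x ∈ range ((↑) : (E ≃L[ℝ] F) → E →L[ℝ] F) := by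
    have h1 : ContinuousAt (fderiv ℝ f) a :=
      (hfa.fderiv_right (m := 0) (by simp)).continuousAt
    apply h1
    rw [hf'.fderiv]
    exact ContinuousLinearEquiv.nhds f'
  have hev : ∀ᶠ x in 𝓝 a, x ∈ O ∧ x ∈ e.source ∧
      fderiv ℝ f x ∈ range ((↑) : (E ≃L[ℝ] F) → E →L[ℝ] F) := by
    filter_upwards [hO.mem_nhds ha, e.open_source.mem_nhds hes, hinv] with x h1 h2 h3
    exact ⟨h1, h2, h3⟩
  obtain ⟨r, hr, hball⟩ := Metric.eventually_nhds_iff_ball.1 hev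
  refine ⟨r, hr, fun x hx => (hball x hx).1, ?_, e.symm, ?_, ?_⟩
  · exact e.isOpen_image_of_subset_source Metric.isOpen_ball fun x hx => (hball x hx).2.1
  · rintro _ ⟨x, hx, rfl⟩
    obtain ⟨h1, h2, g', hg'⟩ := hball x hx
    have hs : e.symm (e x) = x := e.left_inv h2
    refine (e.contDiffAt_symm (f₀' := g') (e.map_source h2) ?_ ?_).contDiffWithinAt
    · rw [hs, hg']
      exact ((hf.contDiffAt (hO.mem_nhds h1)).differentiableAt (by simp)).hasFDerivAt
    · rw [hs]
      exact hf.contDiffAt (hO.mem_nhds h1)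
  · intro w hw
    exact e.left_inv (hball w hw).2.1

section Superposition

variable {K E : Type} [TopologicalSpace K] [CompactSpace K] [NormedAddCommGroup E]
  [NormedSpace ℝ E]

/-- Pointwise application of a continuous family of linear maps to a continuous function. -/
def pointwiseApplyL (F : Type) [NormedAddCommGroup F] [NormedSpace ℝ F] :
    C(K, E →L[ℝ] F) →L[ℝ] C(K, E) →L[ℝ] C(K, F) :=
  LinearMap.mkContinuous₂
    (LinearMap.mk₂ ℝ (fun (A : C(K, E →L[ℝ] F)) (η : C(K, E)) =>
      (⟨fun t => A t (η t), by fun_prop⟩ : C(K, F)))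
      (fun _ _ _ => by ext; simp) (fun _ _ _ => by ext; simp)
      (fun _ _ _ => by ext; simp) (fun _ _ _ => by ext; simp)) 1
    (fun A η => by
      rw [one_mul, ContinuousMap.norm_le _ (by positivity)]
      intro t
      exact ((A t).le_opNorm _).trans
        (mul_le_mul (A.norm_coe_le_norm t) (η.norm_coe_le_norm t) (by positivity)
          (by positivity)))

theorem pointwiseApplyL_apply {F : Type} [NormedAddCommGroup F] [NormedSpace ℝ F]
    (A : C(K, E →L[ℝ] F)) (η : C(K, E)) (t : K) : pointwiseApplyL F A η t = A t (η t) := rfl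

theorem hasFDerivAt_postcomp {F : Type} [NormedAddCommGroup F] [NormedSpace ℝ F] {f : E → F}
    (hf : ContDiff ℝ 1 f) (γ : C(K, E)) :
    HasFDerivAt (fun γ : C(K, E) => (⟨f, hf.continuous⟩ : C(E, F)).comp γ)
      (pointwiseApplyL F
        ((⟨fderiv ℝ f, hf.continuous_fderiv (by simp)⟩ : C(E, E →L[ℝ] F)).comp γ)) γ := by
  rw [hasFDerivAt_iff_isLittleO_nhds_zero, Asymptotics.isLittleO_iff]
  intro ε hε
  have hc : Continuous fun γ : C(K, E) =>
      (⟨fderiv ℝ f, hf.continuous_fderiv (by simp)⟩ : C(E, E →L[ℝ] F)).comp γ :=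
    ContinuousMap.continuous_postcomp _
  obtain ⟨δ, hδ, hδ'⟩ := (Metric.continuous_iff (α := C(K, E)) (β := C(K, E →L[ℝ] F))).1 hc γ ε hε
  filter_upwards [Metric.ball_mem_nhds (0 : C(K, E)) hδ] with η hη
  rw [mem_ball_zero_iff] at hη
  rw [ContinuousMap.norm_le _ (by positivity)]
  intro t
  have hmv := (convex_ball (γ t) δ).norm_image_sub_le_of_norm_hasFDerivWithin_le' (𝕜 := ℝ)
    (f := f) (f' := fderiv ℝ f) (φ := fderiv ℝ f (γ t)) (C := ε)
    (x := γ t) (y := γ t + η t)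
    (fun y _ => (hf.differentiable (by simp) y).hasFDerivAt.hasFDerivWithinAt) ?_
    (Metric.mem_ball_self hδ) ?_
  · refine le_trans (le_of_eq ?_) (hmv.trans ?_)
    · simp [pointwiseApplyL_apply]
    · simpa using mul_le_mul_of_nonneg_left (η.norm_coe_le_norm t) hε.le
  · intro y hy
    have h1 : dist (γ + ContinuousMap.const K (y - γ t)) γ < δ := by
      rw [dist_eq_norm, add_sub_cancel_left]
      have : Nonempty K := ⟨t⟩
      rw [ContinuousMap.norm_lt_iff _ hδ]
      intro s
      simpa [dist_eq_norm] using hy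
    have h2 := (ContinuousMap.dist_apply_le_dist t).trans_lt (hδ' _ h1)
    rw [dist_eq_norm] at h2
    simpa using h2.le
  · simpa using (η.norm_coe_le_norm t).trans_lt hη

theorem contDiff_nat_postcomp (k : ℕ) : ∀ {F : Type} [NormedAddCommGroup F] [NormedSpace ℝ F]
    {f : E → F} (hf : ContDiff ℝ k f),
    ContDiff ℝ k (fun γ : C(K, E) => (⟨f, hf.continuous⟩ : C(E, F)).comp γ) := by
  induction k with
  | zero =>
    intro F _ _ f hf
    exact contDiff_zero.2 (ContinuousMap.continuous_postcomp _)
  | succ k ih =>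
    intro F _ _ f hf
    have hf1 : ContDiff ℝ 1 f := hf.of_le (by norm_cast; omega)
    have hd : ContDiff ℝ k (fderiv ℝ f) := hf.fderiv_right (by norm_cast)
    exact contDiff_succ_iff_hasFDerivAt.2 ⟨_, (pointwiseApplyL F).contDiff.comp (ih hd), hasFDerivAt_postcomp hf1⟩

theorem contDiff_postcomp {F : Type} [NormedAddCommGroup F] [NormedSpace ℝ F] {f : E → F}
    (hf : ContDiff ℝ ∞ f) :
    ContDiff ℝ ∞ (fun γ : C(K, E) => (⟨f, hf.continuous⟩ : C(E, F)).comp γ) :=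
  contDiff_infty.2 fun k => contDiff_nat_postcomp k (hf.of_le (by exact_mod_cast le_top))

end Superposition

/-- The primitive vanishing at `0` of a continuous function on the unit interval. -/
def unitPrimitive (E : Type) [NormedAddCommGroup E] [NormedSpace ℝ E] [CompleteSpace E] :
    C(unitInterval, E) →L[ℝ] C(unitInterval, E) :=
  LinearMap.mkContinuous
    { toFun := fun γ => ⟨fun r => ∫ s in (0 : ℝ)..r, γ (projIcc 0 1 zero_le_one s), by
        have h : Continuous fun r : ℝ => ∫ s in (0 : ℝ)..r, γ (projIcc 0 1 zero_le_one s) :=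
          intervalIntegral.continuous_primitive
            (fun a b => Continuous.intervalIntegrable (by fun_prop) _ _) 0
        exact h.comp continuous_subtype_val⟩
      map_add' := fun γ η => by
        ext r
        simp only [ContinuousMap.add_apply, ContinuousMap.coe_mk]
        exact intervalIntegral.integral_add (Continuous.intervalIntegrable (by fun_prop) _ _)
          (Continuous.intervalIntegrable (by fun_prop) _ _)
      map_smul' := fun c γ => by
        ext r
        simp } 1
    (fun γ => by
      rw [one_mul, ContinuousMap.norm_le _ (by positivity)]
      intro r
      have h := intervalIntegral.norm_integral_le_of_norm_le_const (a := (0 : ℝ)) (b := (r : ℝ))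
        (f := fun s => γ (projIcc 0 1 zero_le_one s)) (C := ‖γ‖)
        (fun s _ => γ.norm_coe_le_norm _)
      refine h.trans ?_
      rw [sub_zero, abs_of_nonneg r.2.1]
      exact mul_le_of_le_one_right (by positivity) r.2.2)

theorem unitPrimitive_apply {E : Type} [NormedAddCommGroup E] [NormedSpace ℝ E] [CompleteSpace E]
    (γ : C(unitInterval, E)) (r : unitInterval) :
    unitPrimitive E γ r = ∫ s in (0 : ℝ)..r, γ (projIcc 0 1 zero_le_one s) := rfl

/-- The constant functions, as a continuous linear map. -/
def constCurveL (E : Type) [NormedAddCommGroup E] [NormedSpace ℝ E] :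
    E →L[ℝ] C(unitInterval, E) :=
  LinearMap.mkContinuous
    { toFun := fun x => ContinuousMap.const _ x
      map_add' := fun _ _ => rfl
      map_smul' := fun _ _ => rfl } 1
    (fun x => by
      rw [one_mul, ContinuousMap.norm_le _ (by positivity)]
      intro r
      rfl)

theorem constCurveL_apply {E : Type} [NormedAddCommGroup E] [NormedSpace ℝ E]
    (x : E) (r : unitInterval) : constCurveL E x r = x := rfl

/-- The defect of the time-rescaled integral equation of the vector field `f`, jointly with the
time and the initial point. -/
def flowDefect {E : Type} [NormedAddCommGroup E] [NormedSpace ℝ E] [CompleteSpace E] (f : C(E, E))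
    (z : (ℝ × E) × C(unitInterval, E)) : (ℝ × E) × C(unitInterval, E) :=
  (z.1, z.2 - constCurveL E z.1.2 - z.1.1 • unitPrimitive E (f.comp z.2))

/-- A smooth vector field has a smooth local flow. -/
theorem exists_smooth_local_flow {E : Type} [NormedAddCommGroup E] [NormedSpace ℝ E]
    [CompleteSpace E] {f : E → E} (hf : ContDiff ℝ ∞ f) (p : E) :
    ∃ (fl : ℝ × E → E) (O : Set (ℝ × E)), IsOpen O ∧ ((0 : ℝ), p) ∈ O ∧ ContDiffOn ℝ ∞ fl O ∧
      (∀ z ∈ O, fl (0, z.2) = z.2) ∧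
      ∀ z ∈ O, HasDerivAt (fun s => fl (s, z.2)) (f (fl z)) z.1 := by
  obtain ⟨ε, hε, a, r, _, _, hr, hpl⟩ :=
    IsPicardLindelof.of_contDiffAt_one (hf.contDiffAt.of_le (by simp) : ContDiffAt ℝ 1 f p)
  obtain ⟨α, hα, hαc⟩ := (hpl 0).exists_forall_mem_closedBall_eq_hasDerivWithinAt_continuousOn
  simp only [zero_sub, zero_add] at hα hαc
  let fc : C(E, E) := ⟨f, hf.continuous⟩
  have hT : ContDiff ℝ ∞ (flowDefect fc) := by
    have h1 : ContDiff ℝ ∞ fun γ : C(unitInterval, E) => fc.comp γ := contDiff_postcomp hf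
    exact contDiff_fst.prodMk ((contDiff_snd.sub
      ((constCurveL E).contDiff.comp (contDiff_snd.comp contDiff_fst))).sub
      ((contDiff_fst.comp contDiff_fst).smul
        ((unitPrimitive E).contDiff.comp (h1.comp contDiff_snd))))
  let z₀ : (ℝ × E) × C(unitInterval, E) := (((0 : ℝ), p), constCurveL E p)
  let A : (ℝ × E) →L[ℝ] C(unitInterval, E) :=
    -((constCurveL E).comp (ContinuousLinearMap.snd ℝ ℝ E)) -
      (ContinuousLinearMap.fst ℝ ℝ E).smulRight (unitPrimitive E (fc.comp (constCurveL E p)))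
  have hT' : HasFDerivAt (flowDefect fc)
      (((ContinuousLinearEquiv.refl ℝ (ℝ × E)).skewProd
        (ContinuousLinearEquiv.refl ℝ C(unitInterval, E)) A :
          ((ℝ × E) × C(unitInterval, E)) ≃L[ℝ] (ℝ × E) × C(unitInterval, E)) :
        ((ℝ × E) × C(unitInterval, E)) →L[ℝ] (ℝ × E) × C(unitInterval, E)) z₀ := by
    have h1 : HasFDerivAt (fun γ : C(unitInterval, E) => fc.comp γ) _ (constCurveL E p) :=
      hasFDerivAt_postcomp (hf.of_le (by simp)) _
    have h2 := HasFDerivAt.comp (f := Prod.snd) z₀ (((unitPrimitive E).hasFDerivAt).comp _ h1)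
      (hasFDerivAt_snd (𝕜 := ℝ) (p := z₀))
    have h3 := ((hasFDerivAt_fst (𝕜 := ℝ) (p := z₀.1)).comp z₀ (hasFDerivAt_fst (p := z₀))).smul h2
    have h4 := ((constCurveL E).hasFDerivAt.comp z₀
      ((hasFDerivAt_snd (𝕜 := ℝ) (p := z₀.1)).comp z₀ (hasFDerivAt_fst (p := z₀))))
    have h5 := (hasFDerivAt_fst (𝕜 := ℝ) (p := z₀)).prodMk
      (((hasFDerivAt_snd (p := z₀)).sub h4).sub h3)
    refine h5.congr_fderiv ?_
    ext w <;> simp [A, z₀]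
  obtain ⟨ρ, hρ, -, hopen, Ψ, hΨ, hΨT⟩ := exists_ball_smooth_leftInverse isOpen_univ
    hT.contDiffOn (mem_univ z₀) hT'
  have hTz : flowDefect fc z₀ = (((0 : ℝ), p), 0) := by
    simp [flowDefect, z₀]
  let D : Set (ℝ × E) := {z | (z, (0 : C(unitInterval, E))) ∈ flowDefect fc '' Metric.ball z₀ ρ}
  have hD : IsOpen D := hopen.preimage (by fun_prop)
  have h0D : ((0 : ℝ), p) ∈ D := ⟨z₀, Metric.mem_ball_self hρ, hTz⟩
  -- near `(0, p)` the flow stays close to `p`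
  have hαat : ContinuousAt α (p, 0) := hαc.continuousAt
    (prod_mem_nhds (Metric.closedBall_mem_nhds _ hr) (Icc_mem_nhds (by linarith) hε))
  have hαp : α (p, 0) = p := (hα p (Metric.mem_closedBall_self (by positivity))).1
  have hnear : ∀ᶠ z in 𝓝 (p, (0 : ℝ)), dist (α z) p < ρ := by
    have := hαat (Metric.ball_mem_nhds _ hρ)
    rw [hαp] at this
    exact this
  obtain ⟨δ, hδ, hδ'⟩ := Metric.eventually_nhds_iff_ball.1 hnear
  let d : ℝ := min (min δ ρ) (min r ε)
  have hd : 0 < d := by positivity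
  have hcb : ∀ x, dist x p < d → x ∈ Metric.closedBall p (r : ℝ) := fun x hx =>
    Metric.mem_closedBall.2 (hx.le.trans ((min_le_right _ _).trans (min_le_left _ _)))
  have key : ∀ z ∈ Metric.ball ((0 : ℝ), p) d, (Ψ (z, 0)).2 1 = α (z.2, z.1) := by
    intro z hz
    rw [← ball_prod_same] at hz
    obtain ⟨hz1, hz2⟩ := hz
    have hz1' : |z.1| < d := by simpa using hz1
    have hz2' : dist z.2 p < d := hz2
    have hdδ : d ≤ δ := (min_le_left _ _).trans (min_le_left _ _)
    have hdρ : d ≤ ρ := (min_le_left _ _).trans (min_le_right _ _)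
    have hdε : d ≤ ε := (min_le_right _ _).trans (min_le_right _ _)
    have hzr : z.2 ∈ Metric.closedBall p r := hcb _ hz2'
    have hscale : ∀ s ∈ Icc (0 : ℝ) 1, |z.1 * s| < d := by
      intro s hs
      rw [abs_mul, abs_of_nonneg hs.1]
      exact (mul_le_of_le_one_right (abs_nonneg _) hs.2).trans_lt hz1'
    have hder : ∀ s ∈ Icc (0 : ℝ) 1, HasDerivAt (fun s => α (z.2, z.1 * s))
        (z.1 • f (α (z.2, z.1 * s))) s := by
      intro s hs
      have hlt := abs_lt.1 ((hscale s hs).trans_le hdε)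
      have h1 : HasDerivAt (fun t => α (z.2, t)) (f (α (z.2, z.1 * s))) (z.1 * s) :=
        ((hα _ hzr).2 _ ⟨hlt.1.le, hlt.2.le⟩).hasDerivAt (Icc_mem_nhds hlt.1 hlt.2)
      have h2 : HasDerivAt (fun s => z.1 * s) z.1 s := by
        simpa using (hasDerivAt_id s).const_mul z.1
      exact h1.scomp s h2
    have hcont : ContinuousOn (fun s => α (z.2, z.1 * s)) (Icc 0 1) :=
      fun s hs => (hder s hs).continuousAt.continuousWithinAt
    let γ : C(unitInterval, E) := ⟨fun s => α (z.2, z.1 * s), hcont.domRestrict⟩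
    have hγ : ∀ s : unitInterval, γ s = α (z.2, z.1 * s) := fun _ => rfl
    have hmem : (z, γ) ∈ Metric.ball z₀ ρ := by
      rw [← ball_prod_same]
      refine ⟨?_, ?_⟩
      · rw [← ball_prod_same]
        exact ⟨Metric.ball_subset_ball hdρ hz1, Metric.ball_subset_ball hdρ hz2⟩
      · rw [Metric.mem_ball, ContinuousMap.dist_lt_iff hρ]
        intro s
        refine hδ' _ ?_
        rw [← ball_prod_same]
        exact ⟨Metric.ball_subset_ball hdδ hz2, by
          simpa using (hscale s s.2).trans_le hdδ⟩
    have hTγ : flowDefect fc (z, γ) = (z, 0) := by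
      refine Prod.ext rfl ?_
      ext t
      have hconst : ∫ s in (0 : ℝ)..t, z.1 • f (α (z.2, z.1 * s)) =
          α (z.2, z.1 * t) - α (z.2, z.1 * 0) := by
        have hsub : uIcc (0 : ℝ) t ⊆ Icc 0 1 := by
          rw [uIcc_of_le t.2.1]
          exact Icc_subset_Icc le_rfl t.2.2
        refine intervalIntegral.integral_eq_sub_of_hasDerivAt (fun s hs => hder s (hsub hs)) ?_
        refine ContinuousOn.intervalIntegrable ?_
        exact ((hf.continuous.comp_continuousOn hcont).mono hsub).const_smul _
      have hconst' : ∫ s in (0 : ℝ)..t, (fc.comp γ) (projIcc 0 1 zero_le_one s) =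
          ∫ s in (0 : ℝ)..t, f (α (z.2, z.1 * s)) := by
        refine intervalIntegral.integral_congr fun s hs => ?_
        rw [uIcc_of_le t.2.1] at hs
        have hs' : s ∈ Icc (0 : ℝ) 1 := ⟨hs.1, hs.2.trans t.2.2⟩
        simp [fc, hγ, projIcc_of_mem _ hs']
      rw [intervalIntegral.integral_smul, mul_zero, (hα _ hzr).1] at hconst
      simp only [flowDefect, ContinuousMap.sub_apply, ContinuousMap.smul_apply,
        unitPrimitive_apply, constCurveL_apply, hconst', hconst, ContinuousMap.zero_apply]
      simp [hγ]
    have hinv := hΨT _ hmem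
    rw [hTγ] at hinv
    rw [hinv]
    simp [hγ]
  refine ⟨fun z => (Ψ (z, 0)).2 1, D ∩ Metric.ball (0, p) d, hD.inter Metric.isOpen_ball,
    ⟨h0D, Metric.mem_ball_self hd⟩, ?_, ?_, ?_⟩
  · have h1 : ContDiffOn ℝ ∞ (fun z : ℝ × E => Ψ (z, 0)) (D ∩ Metric.ball (0, p) d) :=
      hΨ.comp (contDiff_id.prodMk contDiff_const).contDiffOn fun z hz => hz.1
    exact (ContinuousMap.evalCLM ℝ (1 : unitInterval)).contDiff.comp_contDiffOn
      (contDiff_snd.comp_contDiffOn h1)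
  · rintro z ⟨-, hz⟩
    rw [← ball_prod_same] at hz
    have h0 : ((0 : ℝ), z.2) ∈ Metric.ball ((0 : ℝ), p) d := by
      rw [← ball_prod_same]
      exact ⟨Metric.mem_ball_self hd, hz.2⟩
    change (Ψ (((0 : ℝ), z.2), 0)).2 1 = z.2
    rw [key _ h0]
    exact (hα _ (hcb _ hz.2)).1
  · rintro z ⟨-, hz⟩
    have hev : (fun s => (Ψ ((s, z.2), 0)).2 1) =ᶠ[𝓝 z.1] fun s => α (z.2, s) := by
      have hc : ContinuousAt (fun s : ℝ => (s, z.2)) z.1 := by fun_prop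
      filter_upwards [hc.preimage_mem_nhds (Metric.isOpen_ball.mem_nhds hz)] with s hs
      exact key _ hs
    refine HasDerivAt.congr_of_eventuallyEq ?_ hev
    simp only [key z hz]
    rw [← ball_prod_same] at hz
    have h1 : |z.1| < ε := by
      have : |z.1| < d := by simpa using hz.1
      exact this.trans_le ((min_le_right _ _).trans (min_le_right _ _))
    have h2 := abs_lt.1 h1
    exact ((hα _ (hcb _ hz.2)).2 _
      ⟨h2.1.le, h2.2.le⟩).hasDerivAt (Icc_mem_nhds h2.1 h2.2)

/-! ### The inner product -/

section Minner

variable {n : ℕ} {g : Met n} {x : Pt n}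

theorem minner_eq_dotProduct (g : Met n) (x v w : Pt n) :
    minner g x v w = v ⬝ᵥ (Matrix.of (g x)).mulVec w := by
  simp only [minner, dotProduct, Matrix.mulVec, Matrix.of_apply, Finset.mul_sum]
  exact Finset.sum_congr rfl fun i _ => Finset.sum_congr rfl fun j _ => by ring

theorem minner_add_left (g : Met n) (x v v' w : Pt n) :
    minner g x (v + v') w = minner g x v w + minner g x v' w := by
  simp [minner_eq_dotProduct, add_dotProduct]

theorem minner_smul_left (g : Met n) (x : Pt n) (c : ℝ) (v w : Pt n) :
    minner g x (c • v) w = c * minner g x v w := by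
  simp [minner_eq_dotProduct, smul_dotProduct]

theorem minner_add_right (g : Met n) (x v w w' : Pt n) :
    minner g x v (w + w') = minner g x v w + minner g x v w' := by
  simp [minner_eq_dotProduct, Matrix.mulVec_add, dotProduct_add]

theorem minner_smul_right (g : Met n) (x : Pt n) (c : ℝ) (v w : Pt n) :
    minner g x v (c • w) = c * minner g x v w := by
  simp [minner_eq_dotProduct, Matrix.mulVec_smul, dotProduct_smul]

theorem minner_zero_left (g : Met n) (x w : Pt n) : minner g x 0 w = 0 := by
  simp [minner_eq_dotProduct]

theorem minner_zero_right (g : Met n) (x v : Pt n) : minner g x v 0 = 0 := by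
  simp [minner_eq_dotProduct]

theorem minner_sub_left (g : Met n) (x v v' w : Pt n) :
    minner g x (v - v') w = minner g x v w - minner g x v' w := by
  simp [minner_eq_dotProduct, sub_dotProduct]

theorem minner_comm (hs : ∀ x i j, g x i j = g x j i) (v w : Pt n) :
    minner g x v w = minner g x w v := by
  rw [minner, minner, Finset.sum_comm]
  exact Finset.sum_congr rfl fun i _ => Finset.sum_congr rfl fun j _ => by rw [hs x j i]; ring

/-- The inner product with `v` as a continuous linear form. -/
def minnerL (g : Met n) (x v : Pt n) : Pt n →L[ℝ] ℝ :=
  LinearMap.toContinuousLinearMap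
    { toFun := fun w => minner g x v w
      map_add' := minner_add_right g x v
      map_smul' := fun c w => minner_smul_right g x c v w }

@[simp] theorem minnerL_apply (g : Met n) (x v w : Pt n) : minnerL g x v w = minner g x v w := rfl

theorem isUnit_det_of_isMetricOn {U : Set (Pt n)} (hg : IsMetricOn U g) (hx : x ∈ U) :
    IsUnit (Matrix.of (g x)).det := by
  rw [isUnit_iff_ne_zero]
  intro h
  obtain ⟨v, hv, hv0⟩ := Matrix.exists_mulVec_eq_zero_iff.2 h
  have := hg.2.2 x hx v hv
  rw [minner_eq_dotProduct, hv0, dotProduct_zero] at this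
  exact lt_irrefl _ this

theorem eq_zero_of_minner_eq_zero {U : Set (Pt n)} (hg : IsMetricOn U g) (hx : x ∈ U) {v : Pt n}
    (h : minner g x v v = 0) : v = 0 := by
  by_contra hv
  exact (hg.2.2 x hx v hv).ne' h

theorem sum_smul_stdb (v : Pt n) : ∑ i, v i • stdb n i = v := by
  ext k
  simp [stdb, Pi.single_apply]

theorem map_eq_sum_stdb {F : Type*} [AddCommGroup F] [Module ℝ F] [TopologicalSpace F]
    (L : Pt n →L[ℝ] F) (v : Pt n) : L v = ∑ i, v i • L (stdb n i) := by
  conv_lhs => rw [← sum_smul_stdb v]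
  simp

end Minner

/-! ### The Levi-Civita connection along maps -/

section Connection

variable {m n : ℕ} {g : Met n}

/-- The Christoffel symbols as a bilinear map on vectors. -/
def chrisV (g : Met n) (x a b : Pt n) : Pt n :=
  fun k => ∑ i, ∑ j, christoffel g x k i j * a i * b j

/-- The derivative of the coefficients of the metric in the direction `a`, as a bilinear form. -/
def dmet (g : Met n) (x a b c : Pt n) : ℝ :=
  ∑ i, ∑ j, fderiv ℝ (fun y => g y i j) x a * b i * c j

/-- The covariant derivative of a field `W` along a map `F` between coordinate spaces. -/
def covMap (g : Met n) (F W : Pt m → Pt n) (u v : Pt m) : Pt n :=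
  fun k => fderiv ℝ (fun y => W y k) u v +
    ∑ i, ∑ j, christoffel g (F u) k i j * fderiv ℝ F u v i * W u j

theorem minner_chrisV {U : Set (Pt n)} (hg : IsMetricOn U g) {x : Pt n} (hx : x ∈ U)
    (a b c : Pt n) :
    minner g x (chrisV g x a b) c = 1 / 2 * (dmet g x a b c + dmet g x b a c - dmet g x c a b) := by
  let T : Fin n → Fin n → Fin n → ℝ := fun l i j =>
    fderiv ℝ (fun y => g y j l) x (stdb n i) + fderiv ℝ (fun y => g y i l) x (stdb n j)
      - fderiv ℝ (fun y => g y i j) x (stdb n l)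
  have h1 : chrisV g x a b = ((Matrix.of (g x))⁻¹).mulVec
      (fun l => 1 / 2 * ∑ i, ∑ j, T l i j * a i * b j) := by
    ext k
    simp only [chrisV, christoffel, Matrix.mulVec, dotProduct, Finset.mul_sum, Finset.sum_mul]
    rw [Finset.sum_comm_cycle]
    refine Finset.sum_congr rfl fun l _ => Finset.sum_congr rfl fun i _ =>
      Finset.sum_congr rfl fun j _ => ?_
    simp only [ginv, T]
    ring
  have hD : ∀ i j (v : Pt n), fderiv ℝ (fun y => g y i j) x v =
      ∑ l, v l * fderiv ℝ (fun y => g y i j) x (stdb n l) := fun i j v => map_eq_sum_stdb _ v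
  rw [minner_comm hg.2.1, minner_eq_dotProduct, h1, Matrix.mulVec_mulVec,
    Matrix.mul_nonsing_inv _ (isUnit_det_of_isMetricOn hg hx), Matrix.one_mulVec]
  have e1 : dmet g x a b c = ∑ l, ∑ i, ∑ j,
      fderiv ℝ (fun y => g y j l) x (stdb n i) * a i * b j * c l := by
    simp only [dmet, hD _ _ a, Finset.sum_mul]
    rw [Finset.sum_comm]
    refine Finset.sum_congr rfl fun l _ => ?_
    rw [Finset.sum_comm]
    exact Finset.sum_congr rfl fun i _ => Finset.sum_congr rfl fun j _ => by ring
  have e2 : dmet g x b a c = ∑ l, ∑ i, ∑ j,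
      fderiv ℝ (fun y => g y i l) x (stdb n j) * a i * b j * c l := by
    simp only [dmet, hD _ _ b, Finset.sum_mul]
    rw [Finset.sum_comm]
    exact Finset.sum_congr rfl fun l _ => Finset.sum_congr rfl fun i _ =>
      Finset.sum_congr rfl fun j _ => by ring
  have e3 : dmet g x c a b = ∑ l, ∑ i, ∑ j,
      fderiv ℝ (fun y => g y i j) x (stdb n l) * a i * b j * c l := by
    simp only [dmet, hD _ _ c, Finset.sum_mul]
    rw [Finset.sum_comm_cycle]
    exact Finset.sum_congr rfl fun l _ => Finset.sum_congr rfl fun i _ =>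
      Finset.sum_congr rfl fun j _ => by ring
  rw [e1, e2, e3]
  simp only [dotProduct, ← Finset.sum_add_distrib, ← Finset.sum_sub_distrib, Finset.mul_sum]
  exact Finset.sum_congr rfl fun l _ => Finset.sum_congr rfl fun i _ =>
      Finset.sum_congr rfl fun j _ => by simp only [T]; ring

theorem dmet_comm (hs : ∀ x i j, g x i j = g x j i) (x a b c : Pt n) :
    dmet g x a b c = dmet g x a c b := by
  rw [dmet, dmet, Finset.sum_comm]
  refine Finset.sum_congr rfl fun i _ => Finset.sum_congr rfl fun j _ => ?_
  rw [show (fun y => g y j i) = fun y => g y i j from funext fun y => hs y j i]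
  ring

theorem dmet_eq_minner_chrisV {U : Set (Pt n)} (hg : IsMetricOn U g) {x : Pt n} (hx : x ∈ U)
    (a b c : Pt n) :
    dmet g x a b c = minner g x (chrisV g x a b) c + minner g x b (chrisV g x a c) := by
  rw [minner_comm hg.2.1 b, minner_chrisV hg hx, minner_chrisV hg hx, dmet_comm hg.2.1 x a c b,
    dmet_comm hg.2.1 x b a c, dmet_comm hg.2.1 x c a b]
  ring

theorem chrisV_comm (hs : ∀ x i j, g x i j = g x j i) (x a b : Pt n) :
    chrisV g x a b = chrisV g x b a := by
  ext k
  rw [chrisV, chrisV, Finset.sum_comm]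
  refine Finset.sum_congr rfl fun i _ => Finset.sum_congr rfl fun j _ => ?_
  have : christoffel g x k j i = christoffel g x k i j := by
    rw [christoffel, christoffel]
    congr 1
    refine Finset.sum_congr rfl fun l _ => ?_
    rw [show (fun y => g y j i) = fun y => g y i j from funext fun y => hs y j i]
    ring
  rw [this]
  ring

theorem chrisV_smul_right (g : Met n) (x a : Pt n) (c : ℝ) (b : Pt n) :
    chrisV g x a (c • b) = c • chrisV g x a b := by
  ext k
  simp only [chrisV, Pi.smul_apply, smul_eq_mul, Finset.mul_sum]
  exact Finset.sum_congr rfl fun i _ => Finset.sum_congr rfl fun j _ => by ring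

theorem fderiv_coord {W : Pt m → Pt n} {u : Pt m} (hW : DifferentiableAt ℝ W u) (v : Pt m)
    (k : Fin n) : fderiv ℝ (fun y => W y k) u v = fderiv ℝ W u v k := by
  have := (hasFDerivAt_pi'.1 hW.hasFDerivAt k).fderiv
  rw [this]
  rfl

theorem covMap_eq {F W : Pt m → Pt n} {u : Pt m} (hW : DifferentiableAt ℝ W u) (v : Pt m) :
    covMap g F W u v = fderiv ℝ W u v + chrisV g (F u) (fderiv ℝ F u v) (W u) := by
  ext k
  simp only [covMap, chrisV, Pi.add_apply, fderiv_coord hW]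

theorem covD_eq_covMap (g : Met n) (Y : Pt n → Pt n) (x v : Pt n) :
    covD g Y x v = covMap g id Y x v := by
  ext k
  simp [covD, covMap]

theorem covMap_congr {F W W' : Pt m → Pt n} {u : Pt m} (h : W =ᶠ[𝓝 u] W') (v : Pt m) :
    covMap g F W u v = covMap g F W' u v := by
  ext k
  have hk : (fun y => W y k) =ᶠ[𝓝 u] fun y => W' y k := h.mono fun y hy => by simp only [hy]
  simp only [covMap, hk.fderiv_eq, h.self_of_nhds]

/-- Naturality: the covariant derivative of a field restricted along a map. -/
theorem covMap_comp {F : Pt m → Pt n} {Y : Pt n → Pt n} {u : Pt m}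
    (hF : DifferentiableAt ℝ F u) (hY : DifferentiableAt ℝ Y (F u)) (v : Pt m) :
    covMap g F (fun y => Y (F y)) u v = covD g Y (F u) (fderiv ℝ F u v) := by
  rw [covD_eq_covMap, covMap_eq hY, show (fun y => Y (F y)) = Y ∘ F from rfl,
    covMap_eq (hY.comp u hF), fderiv_comp u hY hF]
  simp

theorem fderiv_minner {F V W : Pt m → Pt n} {u : Pt m}
    (hgd : ∀ i j, DifferentiableAt ℝ (fun y => g y i j) (F u)) (hF : DifferentiableAt ℝ F u)
    (hV : DifferentiableAt ℝ V u) (hW : DifferentiableAt ℝ W u) (v : Pt m) :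
    fderiv ℝ (fun y => minner g (F y) (V y) (W y)) u v =
      dmet g (F u) (fderiv ℝ F u v) (V u) (W u) + minner g (F u) (fderiv ℝ V u v) (W u) +
        minner g (F u) (V u) (fderiv ℝ W u v) := by
  have h : HasFDerivAt (fun y => minner g (F y) (V y) (W y)) _ u :=
    HasFDerivAt.fun_sum fun i _ => HasFDerivAt.fun_sum fun j _ =>
      (((hgd i j).hasFDerivAt.comp u hF.hasFDerivAt).mul
        (hasFDerivAt_pi'.1 hV.hasFDerivAt i)).mul (hasFDerivAt_pi'.1 hW.hasFDerivAt j)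
  rw [h.fderiv]
  simp only [dmet, minner, ← Finset.sum_add_distrib, sum_apply]
  refine Finset.sum_congr rfl fun i _ => Finset.sum_congr rfl fun j _ => ?_
  simp
  ring

/-- The Levi-Civita connection is compatible with the metric. -/
theorem fderiv_minner_eq_covMap {U : Set (Pt n)} (hU : IsOpen U) (hg : IsMetricOn U g)
    {F V W : Pt m → Pt n} {u : Pt m} (hu : F u ∈ U) (hF : DifferentiableAt ℝ F u)
    (hV : DifferentiableAt ℝ V u) (hW : DifferentiableAt ℝ W u) (v : Pt m) :
    fderiv ℝ (fun y => minner g (F y) (V y) (W y)) u v =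
      minner g (F u) (covMap g F V u v) (W u) + minner g (F u) (V u) (covMap g F W u v) := by
  rw [fderiv_minner (fun i j => ((hg.1 i j).contDiffAt (hU.mem_nhds hu)).differentiableAt
    (by simp)) hF hV hW, covMap_eq hV, covMap_eq hW, dmet_eq_minner_chrisV hg hu,
    minner_add_left, minner_add_right]
  ring

/-- The Levi-Civita connection is torsion free. -/
theorem covMap_fderiv_comm (hs : ∀ x i j, g x i j = g x j i) {F : Pt m → Pt n} {u : Pt m}
    (hF : ContDiffAt ℝ ∞ F u) (a b : Pt m) :
    covMap g F (fun y => fderiv ℝ F y a) u b = covMap g F (fun y => fderiv ℝ F y b) u a := by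
  have hd : DifferentiableAt ℝ (fderiv ℝ F) u :=
    (hF.fderiv_right (m := 1) (by norm_cast)).differentiableAt (by simp)
  have hda : ∀ a b, fderiv ℝ (fun y => fderiv ℝ F y a) u b = fderiv ℝ (fderiv ℝ F) u b a := by
    intro a b
    rw [fderiv_clm_apply hd (differentiableAt_const a)]
    simp
  have hsym : IsSymmSndFDerivAt ℝ F u := hF.isSymmSndFDerivAt (by
    rw [minSmoothness_of_isRCLikeNormedField]; norm_cast)
  rw [covMap_eq (hd.clm_apply (differentiableAt_const a)),
    covMap_eq (hd.clm_apply (differentiableAt_const b)), hda, hda, hsym.eq, chrisV_comm hs]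

theorem contDiffOn_minner {U : Set (Pt n)} (hg : IsMetricOn U g) {O : Set (Pt m)}
    {F V W : Pt m → Pt n} (hF : ContDiffOn ℝ ∞ F O) (hFO : MapsTo F O U)
    (hV : ContDiffOn ℝ ∞ V O) (hW : ContDiffOn ℝ ∞ W O) :
    ContDiffOn ℝ ∞ (fun y => minner g (F y) (V y) (W y)) O := by
  unfold minner
  have h1 := contDiffOn_pi.1 hV
  have h2 := contDiffOn_pi.1 hW
  have h3 : ∀ i j, ContDiffOn ℝ ∞ (fun y => g (F y) i j) O := fun i j => (hg.1 i j).comp hF hFO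
  exact ContDiffOn.sum fun i _ => ContDiffOn.sum fun j _ => ((h3 i j).mul (h1 i)).mul (h2 j)

end Connection

/-! ### Products with a line -/

section Product

variable {m n : ℕ} {g : Met n}

/-- The projection onto the base as a continuous linear map. -/
def projBaseL (n : ℕ) : Pt (n + 1) →L[ℝ] Pt n :=
  ContinuousLinearMap.pi fun i => ContinuousLinearMap.proj i.castSucc

theorem projBase_eq (x : Pt (n + 1)) : projBase x = projBaseL n x := rfl

@[simp] theorem projBase_snoc (v : Pt n) (s : ℝ) : projBase (Fin.snoc v s : Pt (n + 1)) = v := by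
  ext i
  simp [projBase]

theorem snoc_projBase (v : Pt (n + 1)) : (Fin.snoc (projBase v) (v (Fin.last n)) : Pt (n + 1)) = v :=
  Fin.snoc_init_self v

theorem minner_prodMet (g : Met n) (x a b : Pt (n + 1)) :
    minner (prodMet g) x a b =
      minner g (projBase x) (projBase a) (projBase b) + a (Fin.last n) * b (Fin.last n) := by
  simp [minner, prodMet, Fin.sum_univ_castSucc, projBase]

theorem isMetricOn_prodMet {U : Set (Pt n)} (hg : IsMetricOn U g) :
    IsMetricOn (projBase ⁻¹' U) (prodMet g) := by
  refine ⟨fun i j => ?_, fun x i j => ?_, fun x hx v hv => ?_⟩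
  · refine Fin.lastCases ?_ (fun i => ?_) i <;> refine Fin.lastCases ?_ (fun j => ?_) j
    · simpa [prodMet] using contDiffOn_const
    · simpa [prodMet] using contDiffOn_const
    · simpa [prodMet] using contDiffOn_const
    · simp only [prodMet, Fin.lastCases_castSucc]
      exact (hg.1 i j).comp (projBaseL n).contDiff.contDiffOn fun x hx => hx
  · refine Fin.lastCases ?_ (fun i => ?_) i <;> refine Fin.lastCases ?_ (fun j => ?_) j <;>
      simp only [prodMet, Fin.lastCases_castSucc, Fin.lastCases_last]
    exact hg.2.1 _ _ _
  · rw [minner_prodMet]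
    by_cases h : projBase v = 0
    · have hl : v (Fin.last n) ≠ 0 := by
        intro hl
        refine hv ?_
        rw [← snoc_projBase v, h, hl]
        ext i
        refine Fin.lastCases ?_ (fun i => ?_) i <;> simp
      rw [h, minner_zero_left, zero_add]
      exact mul_self_pos.2 hl
    · have := hg.2.2 _ hx _ h
      nlinarith [mul_self_nonneg (v (Fin.last n))]

theorem dmet_prodMet {U : Set (Pt n)} (hU : IsOpen U) (hg : IsMetricOn U g) {x : Pt (n + 1)}
    (hx : projBase x ∈ U) (a b c : Pt (n + 1)) :
    dmet (prodMet g) x a b c = dmet g (projBase x) (projBase a) (projBase b) (projBase c) := by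
  have h : ∀ i j : Fin n, fderiv ℝ (fun y => g (projBase y) i j) x a =
      fderiv ℝ (fun y => g y i j) (projBase x) (projBase a) := by
    intro i j
    have h1 : HasFDerivAt (fun y => g y i j) _ (projBase x) :=
      (((hg.1 i j).contDiffAt (hU.mem_nhds hx)).differentiableAt (by simp)).hasFDerivAt
    have h2 : HasFDerivAt (fun y => g (projBase y) i j) _ x :=
      h1.comp x (projBaseL n).hasFDerivAt
    rw [h2.fderiv]
    rfl
  simp [dmet, prodMet, Fin.sum_univ_castSucc, h, projBase]

theorem chrisV_prodMet {U : Set (Pt n)} (hU : IsOpen U) (hg : IsMetricOn U g) {x : Pt (n + 1)}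
    (hx : projBase x ∈ U) (a b : Pt (n + 1)) :
    chrisV (prodMet g) x a b =
      Fin.snoc (chrisV g (projBase x) (projBase a) (projBase b)) 0 := by
  have hG := isMetricOn_prodMet hg
  have key : ∀ c, minner (prodMet g) x (chrisV (prodMet g) x a b -
      (Fin.snoc (chrisV g (projBase x) (projBase a) (projBase b)) 0 : Pt (n + 1))) c = 0 := by
    intro c
    rw [minner_sub_left, minner_chrisV hG hx, minner_prodMet, projBase_snoc, minner_chrisV hg hx,
      dmet_prodMet hU hg hx, dmet_prodMet hU hg hx, dmet_prodMet hU hg hx]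
    simp
  exact sub_eq_zero.1 (eq_zero_of_minner_eq_zero hG hx (key _))

theorem projBase_covMap_prodMet {U : Set (Pt n)} (hU : IsOpen U) (hg : IsMetricOn U g)
    {F W : Pt m → Pt (n + 1)} {u : Pt m} (hu : projBase (F u) ∈ U)
    (hF : DifferentiableAt ℝ F u) (hW : DifferentiableAt ℝ W u) (v : Pt m) :
    projBase (covMap (prodMet g) F W u v) =
      covMap g (fun y => projBase (F y)) (fun y => projBase (W y)) u v := by
  have h : ∀ {Z : Pt m → Pt (n + 1)}, DifferentiableAt ℝ Z u →
      HasFDerivAt (fun y => projBase (Z y)) ((projBaseL n).comp (fderiv ℝ Z u)) u :=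
    fun hZ => (projBaseL n).hasFDerivAt.comp u hZ.hasFDerivAt
  rw [covMap_eq hW, covMap_eq (h hW).differentiableAt, (h hW).fderiv, (h hF).fderiv,
    chrisV_prodMet hU hg hu, projBase_eq, map_add, ← projBase_eq (Fin.snoc _ _), projBase_snoc]
  rfl

theorem covMap_prodMet_last {U : Set (Pt n)} (hU : IsOpen U) (hg : IsMetricOn U g)
    {F W : Pt m → Pt (n + 1)} {u : Pt m} (hu : projBase (F u) ∈ U)
    (hW : DifferentiableAt ℝ W u) (v : Pt m) :
    covMap (prodMet g) F W u v (Fin.last n) = fderiv ℝ (fun y => W y (Fin.last n)) u v := by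
  rw [covMap_eq hW, chrisV_prodMet hU hg hu, fderiv_coord hW]
  simp

end Product

/-- The metric `g` admits near `p` a closed conformal field that does not vanish at `p`. -/
def HasClosedConformalField {n : ℕ} (U : Set (Pt n)) (g : Met n) (p : Pt n) : Prop :=
  ∃ O : Set (Pt n), IsOpen O ∧ p ∈ O ∧ O ⊆ U ∧ ∃ (X : Pt n → Pt n) (lam : Pt n → ℝ),
    ContDiffOn ℝ ∞ X O ∧ (∀ x ∈ O, ∀ v, covD g X x v = lam x • v) ∧ X p ≠ 0

section Linear

variable {m n : ℕ}

/-- The covariant derivative along a map, as a linear map of the direction. -/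
def covMapL (g : Met n) (F W : Pt m → Pt n) (u : Pt m) : Pt m →L[ℝ] Pt n :=
  LinearMap.toContinuousLinearMap
    { toFun := covMap g F W u
      map_add' := fun v w => by
        ext k
        simp only [covMap, map_add, Pi.add_apply, mul_add, add_mul, Finset.sum_add_distrib]
        ring
      map_smul' := fun c v => by
        ext k
        simp only [covMap, map_smul, Pi.smul_apply, smul_eq_mul, mul_add, Finset.mul_sum,
          RingHom.id_apply]
        congr 1
        exact Finset.sum_congr rfl fun i _ => Finset.sum_congr rfl fun j _ => by ring }

@[simp] theorem covMapL_apply (g : Met n) (F W : Pt m → Pt n) (u v : Pt m) :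
    covMapL g F W u v = covMap g F W u v := rfl

theorem clm_eq_of_stdb {E : Type*} [AddCommGroup E] [Module ℝ E] [TopologicalSpace E]
    {A B : Pt m →L[ℝ] E} (h : ∀ a, A (stdb m a) = B (stdb m a)) : A = B := by
  ext v
  rw [map_eq_sum_stdb A, map_eq_sum_stdb B]
  exact Finset.sum_congr rfl fun a _ => by rw [h]

/-- The inverse function theorem, on a ball, for maps with injective derivative. -/
theorem exists_ball_smooth_leftInverse_of_injective {f : Pt n → Pt n} {O : Set (Pt n)}
    (hO : IsOpen O) (hf : ContDiffOn ℝ ∞ f O) {a : Pt n} (ha : a ∈ O)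
    (hinj : ∀ v, fderiv ℝ f a v = 0 → v = 0) :
    ∃ r > 0, Metric.ball a r ⊆ O ∧ IsOpen (f '' Metric.ball a r) ∧ ∃ Ψ : Pt n → Pt n,
      ContDiffOn ℝ ∞ Ψ (f '' Metric.ball a r) ∧ (∀ w ∈ Metric.ball a r, Ψ (f w) = w) := by
  let e : Pt n ≃L[ℝ] Pt n := (LinearEquiv.ofInjectiveEndo (fderiv ℝ f a).toLinearMap
    ((injective_iff_map_eq_zero _).2 hinj)).toContinuousLinearEquiv
  have he : (e : Pt n →L[ℝ] Pt n) = fderiv ℝ f a := by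
    ext v
    rfl
  refine exists_ball_smooth_leftInverse (f' := e) hO hf ha ?_
  rw [he]
  exact ((hf.contDiffAt (hO.mem_nhds ha)).differentiableAt (by simp)).hasFDerivAt

/-- A map with a smooth left inverse on its open image has surjective derivative. -/
theorem surjective_fderiv_of_leftInverse {f Ψ : Pt n → Pt n} {W : Set (Pt n)}
    (hW : IsOpen W) (hf : ContDiffOn ℝ ∞ f W) (hfW : IsOpen (f '' W))
    (hΨ : ContDiffOn ℝ ∞ Ψ (f '' W)) (hl : ∀ w ∈ W, Ψ (f w) = w) {w : Pt n} (hw : w ∈ W) :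
    Function.Surjective (fderiv ℝ f w) := by
  have h1 : HasFDerivAt f _ w :=
    ((hf.contDiffAt (hW.mem_nhds hw)).differentiableAt (by simp)).hasFDerivAt
  have h2 : HasFDerivAt Ψ _ (f w) :=
    ((hΨ.contDiffAt (hfW.mem_nhds ⟨w, hw, rfl⟩)).differentiableAt (by simp)).hasFDerivAt
  have h3 : HasFDerivAt (Ψ ∘ f) (ContinuousLinearMap.id ℝ (Pt n)) w :=
    (hasFDerivAt_id w).congr_of_eventuallyEq
      (Filter.eventuallyEq_of_mem (hW.mem_nhds hw) fun y hy => hl y hy)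
  have h4 := (h2.comp w h1).unique h3
  have h5 : Function.Injective (fderiv ℝ f w).toLinearMap := by
    refine Function.LeftInverse.injective (g := fderiv ℝ Ψ (f w)) fun v => ?_
    exact congrArg (fun A : Pt n →L[ℝ] Pt n => A v) h4
  exact LinearMap.surjective_of_injective h5

end Linear

section Umbilical

variable {n : ℕ} {g : Met n}

theorem minner_prodMet_vert (g : Met n) (x y w : Pt (n + 1)) :
    minner (prodMet g) x (vert n y) w = w (Fin.last n) := by
  have : projBase (vert n y) = 0 := by
    ext i
    simp [projBase, vert, stdb]
  rw [minner_prodMet, this, minner_zero_left]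
  simp [vert, stdb]

/-- The projection to the base of the unit normal field of a totally umbilical hypersurface is a
closed conformal field, near points where the hypersurface is neither vertical nor horizontal. -/
theorem hasClosedConformalField_of_umbilical {U : Set (Pt n)} (hU : IsOpen U)
    (hg : IsMetricOn U g) {I : Set ℝ} {S : Hyp n} (hS : S.IsRegular (prodDom U I) (prodMet g))
    (humb : S.TotallyUmbilical (prodMet g)) {u₀ : Pt n} (hu₀ : u₀ ∈ S.V)
    (hv : S.N u₀ (Fin.last n) ≠ 0)
    (hh : ∃ a, fderiv ℝ S.F u₀ (stdb n a) (Fin.last n) ≠ 0) :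
    HasClosedConformalField U g (projBase (S.F u₀)) := by
  obtain ⟨hV, hF, hFU, hli, hN, -, hN0⟩ := hS
  obtain ⟨lam, hlam⟩ := humb
  have hFd : ∀ u ∈ S.V, DifferentiableAt ℝ S.F u := fun u hu =>
    (hF.contDiffAt (hV.mem_nhds hu)).differentiableAt (by simp)
  have hNd : ∀ u ∈ S.V, DifferentiableAt ℝ S.N u := fun u hu =>
    (hN.contDiffAt (hV.mem_nhds hu)).differentiableAt (by simp)
  have hnormal : ∀ u ∈ S.V, ∀ v, minner (prodMet g) (S.F u) (S.N u) (fderiv ℝ S.F u v) = 0 := by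
    intro u hu v
    have h : (minnerL (prodMet g) (S.F u) (S.N u)).comp (fderiv ℝ S.F u) = 0 :=
      clm_eq_of_stdb fun a => by simpa using hN0 u hu a
    exact congrArg (fun A : Pt n →L[ℝ] ℝ => A v) h
  have humb' : ∀ u ∈ S.V, ∀ v, covMap (prodMet g) S.F S.N u v = lam u • fderiv ℝ S.F u v := by
    intro u hu v
    have h : covMapL (prodMet g) S.F S.N u = lam u • fderiv ℝ S.F u :=
      clm_eq_of_stdb fun a => hlam u hu a
    exact congrArg (fun A : Pt n →L[ℝ] Pt (n + 1) => A v) h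
  let G : Pt n → Pt n := fun y => projBase (S.F y)
  let ν : Pt n → Pt n := fun y => projBase (S.N y)
  have hG : ContDiffOn ℝ ∞ G S.V := (projBaseL n).contDiff.comp_contDiffOn hF
  have hν : ContDiffOn ℝ ∞ ν S.V := (projBaseL n).contDiff.comp_contDiffOn hN
  have hGd : ∀ u ∈ S.V, HasFDerivAt G ((projBaseL n).comp (fderiv ℝ S.F u)) u := fun u hu =>
    (projBaseL n).hasFDerivAt.comp u (hFd u hu).hasFDerivAt
  have hinj : ∀ v, fderiv ℝ G u₀ v = 0 → v = 0 := by
    intro v h0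
    rw [(hGd u₀ hu₀).fderiv] at h0
    have h0 : projBase (fderiv ℝ S.F u₀ v) = 0 := h0
    have h1 := hnormal u₀ hu₀ v
    rw [minner_prodMet, h0, minner_zero_right, zero_add] at h1
    have h2 := (mul_eq_zero.1 h1).resolve_left hv
    have h3 : fderiv ℝ S.F u₀ v = 0 := by
      rw [← snoc_projBase (fderiv ℝ S.F u₀ v), h0, h2]
      ext i
      refine Fin.lastCases ?_ (fun i => ?_) i <;> simp
    rw [map_eq_sum_stdb] at h3
    exact funext (Fintype.linearIndependent_iff.1 (hli u₀ hu₀) v h3)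
  obtain ⟨r, hr, hrV, ho, Ψ, hΨ, hl⟩ :=
    exists_ball_smooth_leftInverse_of_injective hV hG hu₀ hinj
  refine ⟨G '' Metric.ball u₀ r, ho, ⟨u₀, Metric.mem_ball_self hr, rfl⟩, ?_, fun x => ν (Ψ x),
    fun x => lam (Ψ x), ?_, ?_, ?_⟩
  · rintro _ ⟨w, hw, rfl⟩
    exact (hFU w (hrV hw)).1
  · refine hν.comp hΨ ?_
    rintro _ ⟨w, hw, rfl⟩
    rw [hl w hw]
    exact hrV hw
  · rintro _ ⟨w, hw, rfl⟩ v
    obtain ⟨z, rfl⟩ := surjective_fderiv_of_leftInverse Metric.isOpen_ball (hG.mono hrV) ho hΨ hl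
      hw v
    have hwV := hrV hw
    have hΨd : DifferentiableAt ℝ Ψ (G w) :=
      (hΨ.contDiffAt (ho.mem_nhds ⟨w, hw, rfl⟩)).differentiableAt (by simp)
    have hνd : DifferentiableAt ℝ ν w :=
      (hν.contDiffAt (hV.mem_nhds hwV)).differentiableAt (by simp)
    have hXd : DifferentiableAt ℝ (fun x => ν (Ψ x)) (G w) :=
      DifferentiableAt.comp (g := ν) (G w) (by rwa [hl w hw]) hΨd
    rw [← covMap_comp (hGd w hwV).differentiableAt hXd]
    beta_reduce
    rw [hl w hw, covMap_congr (W' := ν)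
      (Filter.eventuallyEq_of_mem (Metric.isOpen_ball.mem_nhds hw) fun y hy => by
        simp only [hl y hy])]
    have := congrArg projBase (humb' w hwV z)
    rw [projBase_covMap_prodMet hU hg (hFU w hwV).1 (hFd w hwV) (hNd w hwV)] at this
    rw [(hGd w hwV).fderiv]
    exact this
  · intro h0
    have h0 : ν (Ψ (G u₀)) = 0 := h0
    rw [hl u₀ (Metric.mem_ball_self hr)] at h0
    obtain ⟨a, ha⟩ := hh
    have h1 := hN0 u₀ hu₀ a
    rw [minner_prodMet, show projBase (S.N u₀) = 0 from h0, minner_zero_left, zero_add] at h1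
    exact (mul_ne_zero hv ha) h1

end Umbilical

section Potential

variable {n : ℕ} {g : Met n}

theorem fderiv_minner_self_of_covD_eq_smul {U : Set (Pt n)} (hU : IsOpen U)
    (hg : IsMetricOn U g) {X : Pt n → Pt n} {x : Pt n} (hx : x ∈ U) (hX : DifferentiableAt ℝ X x)
    {l : ℝ} (hc : ∀ v, covD g X x v = l • v) (u : Pt n) :
    fderiv ℝ (fun x => minner g x (X x) (X x)) x u = 2 * l * minner g x (X x) u := by
  have hcm : ∀ v, covMap g (fun x => x) X x v = l • v := fun v => by
    rw [← hc v, covD_eq_covMap]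
    rfl
  rw [fderiv_minner_eq_covMap (F := fun x => x) hU hg hx differentiableAt_id hX hX, hcm,
    minner_smul_left, minner_smul_right, minner_comm hg.2.1 u]
  ring

/-- A closed conformal field, rescaled by a function of its length, is locally a gradient. -/
theorem exists_potential {U : Set (Pt n)} (hU : IsOpen U)
    (hg : IsMetricOn U g) {p : Pt n} {r : ℝ} (hrU : Metric.ball p r ⊆ U)
    {X : Pt n → Pt n} {lam : Pt n → ℝ} (hX : ContDiffOn ℝ ∞ X (Metric.ball p r))
    (hc : ∀ x ∈ Metric.ball p r, ∀ v, covD g X x v = lam x • v)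
    {k : ℝ → ℝ} {T : Set ℝ} (hT : IsOpen T) (hk : ContDiffOn ℝ ∞ k T)
    (hXT : ∀ x ∈ Metric.ball p r, minner g x (X x) (X x) ∈ T) :
    ∃ A : Pt n → ℝ, ContDiffOn ℝ ∞ A (Metric.ball p r) ∧ A p = 0 ∧
      ∀ x ∈ Metric.ball p r, HasFDerivAt A (k (minner g x (X x) (X x)) • minnerL g x (X x)) x := by
  let B := Metric.ball p r
  have hB : IsOpen B := Metric.isOpen_ball
  have hXd : ∀ x ∈ B, DifferentiableAt ℝ X x := fun x hx =>
    (hX.contDiffAt (hB.mem_nhds hx)).differentiableAt (by simp)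
  have hq : ContDiffOn ℝ ∞ (fun x => minner g x (X x) (X x)) B :=
    contDiffOn_minner (F := fun x => x) hg contDiffOn_id hrU hX hX
  have hkq : ContDiffOn ℝ ∞ (fun x => k (minner g x (X x) (X x))) B := hk.comp hq hXT
  have hXv : ∀ v : Pt n, ContDiffOn ℝ ∞ (fun x => minner g x (X x) v) B := fun v =>
    contDiffOn_minner (F := fun x => x) hg contDiffOn_id hrU hX contDiffOn_const
  let θ : Pt n → Pt n →L[ℝ] ℝ := fun x => k (minner g x (X x) (X x)) • minnerL g x (X x)
  have hθ : ContDiffOn ℝ ∞ θ B := by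
    rw [contDiffOn_clm_apply]
    exact fun v => hkq.mul (hXv v)
  have hcm : ∀ x ∈ B, ∀ v, covMap g (fun x => x) X x v = lam x • v := fun x hx v => by
    rw [← hc x hx v, covD_eq_covMap]
    rfl
  have hdX : ∀ x ∈ B, ∀ u v, fderiv ℝ (fun x => minner g x (X x) v) x u =
      lam x * minner g x u v + minner g x (X x) (chrisV g x u v) := by
    intro x hx u v
    rw [fderiv_minner_eq_covMap (F := fun x => x) (W := fun _ => v) hU hg (hrU hx)
      differentiableAt_id (hXd x hx) (differentiableAt_const v), hcm x hx, minner_smul_left,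
      covMap_eq (differentiableAt_const v)]
    simp
  have hdq : ∀ x ∈ B, ∀ u, fderiv ℝ (fun x => minner g x (X x) (X x)) x u =
      2 * lam x * minner g x (X x) u := fun x hx u =>
    fderiv_minner_self_of_covD_eq_smul hU hg (hrU hx) (hXd x hx) (hc x hx) u
  have hsym : ∀ x ∈ B, ∀ u v, fderiv ℝ θ x u v = fderiv ℝ θ x v u := by
    have key : ∀ x ∈ B, ∀ u v, fderiv ℝ θ x u v =
        k (minner g x (X x) (X x)) *
          (lam x * minner g x u v + minner g x (X x) (chrisV g x u v)) +
        minner g x (X x) v * (deriv k (minner g x (X x) (X x)) *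
          (2 * lam x * minner g x (X x) u)) := by
      intro x hx u v
      have hθd : DifferentiableAt ℝ θ x :=
        (hθ.contDiffAt (hB.mem_nhds hx)).differentiableAt (by simp)
      have h1 : fderiv ℝ θ x u v = fderiv ℝ (fun y => θ y v) x u := by
        rw [fderiv_clm_apply hθd (differentiableAt_const v)]
        simp
      have h2 : HasFDerivAt (fun x => minner g x (X x) v) _ x :=
        (((hXv v).contDiffAt (hB.mem_nhds hx)).differentiableAt (by simp)).hasFDerivAt
      have h3 : HasFDerivAt (fun x => minner g x (X x) (X x)) _ x :=
        ((hq.contDiffAt (hB.mem_nhds hx)).differentiableAt (by simp)).hasFDerivAt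
      have h4 : HasDerivAt k _ (minner g x (X x) (X x)) :=
        ((hk.contDiffAt (hT.mem_nhds (hXT x hx))).differentiableAt (by simp)).hasDerivAt
      have h5 : HasFDerivAt (fun y => θ y v) _ x := (h4.comp_hasFDerivAt x h3).mul h2
      rw [h1, h5.fderiv]
      simp [hdX x hx, hdq x hx]
    intro x hx u v
    rw [key x hx, key x hx, minner_comm hg.2.1 v u, chrisV_comm hg.2.1 x v u]
    ring
  obtain ⟨A, hA⟩ := (convex_ball p r).exists_forall_hasFDerivAt_of_fderiv_symmetric hB
    (hθ.differentiableOn (by simp)) hsym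
  refine ⟨fun x => A x - A p, ?_, sub_self _, fun x hx => (hA x hx).sub_const _⟩
  refine ContDiffOn.sub ?_ contDiffOn_const
  rw [show (∞ : WithTop ℕ∞) = ∞ + 1 from rfl, contDiffOn_succ_iff_fderiv_of_isOpen hB]
  refine ⟨fun x hx => (hA x hx).differentiableAt.differentiableWithinAt, by simp, ?_⟩
  exact hθ.congr fun x hx => (hA x hx).fderiv

end Potential

section Graph

variable {n : ℕ} {g : Met n}

theorem covMap_const_smul {m : ℕ} {F X : Pt m → Pt n} {u : Pt m} (hX : DifferentiableAt ℝ X u)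
    (c : ℝ) (v : Pt m) : covMap g F (fun y => c • X y) u v = c • covMap g F X u v := by
  have h : HasFDerivAt (fun y => c • X y) (c • fderiv ℝ X u) u := hX.hasFDerivAt.const_smul c
  rw [covMap_eq hX, covMap_eq h.differentiableAt, h.fderiv, chrisV_smul_right, smul_add]
  rfl

/-- Appending a last coordinate, as a continuous linear map. -/
def snocL (n : ℕ) : Pt n × ℝ →L[ℝ] Pt (n + 1) :=
  ContinuousLinearMap.pi (Fin.lastCases (ContinuousLinearMap.snd ℝ (Pt n) ℝ)
    fun i => (ContinuousLinearMap.proj i).comp (ContinuousLinearMap.fst ℝ (Pt n) ℝ))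

theorem snocL_apply (v : Pt n) (s : ℝ) : snocL n (v, s) = Fin.snoc v s := by
  ext i
  refine Fin.lastCases ?_ (fun i => ?_) i <;> simp [snocL]

theorem ext_projBase {v w : Pt (n + 1)} (h : projBase v = projBase w)
    (hl : v (Fin.last n) = w (Fin.last n)) : v = w := by
  rw [← snoc_projBase v, ← snoc_projBase w, h, hl]

/-- A closed conformal field yields a totally umbilical graph over the base. -/
theorem exists_umbilical_of_hasClosedConformalField {U : Set (Pt n)} (hU : IsOpen U)
    (hg : IsMetricOn U g) {I : Set ℝ} (hI : IsOpen I) {p : Pt n} {t : ℝ} (ht : t ∈ I)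
    (h : HasClosedConformalField U g p) :
    ∃ S : Hyp n, S.IsRegular (prodDom U I) (prodMet g) ∧ S.TotallyUmbilical (prodMet g) ∧
      ∃ u₀ ∈ S.V, S.F u₀ = Fin.snoc p t ∧ S.N u₀ (Fin.last n) ≠ 0 ∧
        ∃ a, fderiv ℝ S.F u₀ (stdb n a) (Fin.last n) ≠ 0 := by
  obtain ⟨O, hO, hpO, hOU, X, lam, hX, hc, hXp⟩ := h
  let q : Pt n → ℝ := fun x => minner g x (X x) (X x)
  have hq : ContDiffOn ℝ ∞ q O := contDiffOn_minner (F := fun x => x) hg contDiffOn_id hOU hX hX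
  have hqp : 0 < q p := hg.2.2 p (hOU hpO) _ hXp
  let c : ℝ := √(1 / (2 * q p))
  have hc0 : 0 < c := Real.sqrt_pos.2 (by positivity)
  have hc2 : c ^ 2 * q p = 1 / 2 := by
    rw [Real.sq_sqrt (by positivity)]
    field_simp
  let T : Set ℝ := {s | c ^ 2 * s < 1}
  have hT : IsOpen T := isOpen_lt (by fun_prop) (by fun_prop)
  obtain ⟨r, hr, hrO⟩ := Metric.isOpen_iff.1 (hq.continuousOn.isOpen_inter_preimage hO hT) p
    ⟨hpO, show c ^ 2 * q p < 1 by rw [hc2]; norm_num⟩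
  let B := Metric.ball p r
  have hpB : p ∈ B := Metric.mem_ball_self hr
  have hBO : B ⊆ O := fun x hx => (hrO hx).1
  have hBT : ∀ x ∈ B, 0 < 1 - c ^ 2 * q x := fun x hx => sub_pos.2 (hrO hx).2
  have hB : IsOpen B := Metric.isOpen_ball
  let θ : Pt n → ℝ := fun x => √(1 - c ^ 2 * q x)
  have hθ0 : ∀ x ∈ B, 0 < θ x := fun x hx => Real.sqrt_pos.2 (hBT x hx)
  have hθ2 : ∀ x ∈ B, θ x ^ 2 = 1 - c ^ 2 * q x := fun x hx => Real.sq_sqrt (hBT x hx).le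
  have hθ : ContDiffOn ℝ ∞ θ B := (contDiffOn_const.sub (contDiffOn_const.mul (hq.mono hBO))).sqrt
    fun x hx => (hBT x hx).ne'
  obtain ⟨φ, hφ, hφp, hdφ⟩ := exists_potential (k := fun s => -c / √(1 - c ^ 2 * s)) hU hg
    (hBO.trans hOU) (hX.mono hBO) (fun x hx => hc x (hBO hx)) hT (by
      refine contDiffOn_const.div (ContDiffOn.sqrt (by fun_prop) fun s hs => ?_) fun s hs => ?_
      · exact (sub_pos.2 hs).ne'
      · exact (Real.sqrt_pos.2 (sub_pos.2 hs)).ne') fun x hx => (hrO hx).2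
  have hdφ : ∀ x ∈ B, HasFDerivAt φ ((-c / θ x) • minnerL g x (X x)) x := hdφ
  let F : Pt n → Pt (n + 1) := fun x => snocL n (x, t + φ x)
  let N : Pt n → Pt (n + 1) := fun x => snocL n (c • X x, θ x)
  let V : Set (Pt n) := B ∩ (fun x => t + φ x) ⁻¹' I
  have htφ : ContDiffOn ℝ ∞ (fun x => t + φ x) B := contDiffOn_const.add hφ
  have hV : IsOpen V := htφ.continuousOn.isOpen_inter_preimage hB hI
  have hF : ContDiffOn ℝ ∞ F B := (snocL n).contDiff.comp_contDiffOn (contDiffOn_id.prodMk htφ)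
  have hN : ContDiffOn ℝ ∞ N B := 
    have hcX : ContDiffOn ℝ ∞ (fun x => c • X x) B := (hX.mono hBO).const_smul c
    (snocL n).contDiff.comp_contDiffOn (hcX.prodMk hθ)
  have hFd : ∀ x ∈ B, HasFDerivAt F _ x := fun x hx =>
    (snocL n).hasFDerivAt.comp x ((hasFDerivAt_id x).prodMk ((hdφ x hx).const_add t))
  have hdF : ∀ x ∈ B, ∀ v, fderiv ℝ F x v = Fin.snoc v (-c / θ x * minner g x (X x) v) := by
    intro x hx v
    rw [(hFd x hx).fderiv, ← snocL_apply]
    rfl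
  have hXd : ∀ x ∈ B, DifferentiableAt ℝ X x := fun x hx =>
    (hX.contDiffAt (hO.mem_nhds (hBO hx))).differentiableAt (by simp)
  refine ⟨⟨V, F, N⟩, ⟨hV, hF.mono inter_subset_left, fun u hu => ?_, fun u hu => ?_,
    hN.mono inter_subset_left, fun u hu => ?_, fun u hu a => ?_⟩, ⟨fun u => c * lam u,
      fun u hu a => ?_⟩, p, ⟨hpB, ?_⟩, ?_, ?_, ?_⟩
  · have hFu : F u = Fin.snoc u (t + φ u) := snocL_apply _ _
    simp only [prodDom, mem_ofPred_eq, hFu, projBase_snoc, Fin.snoc_last]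
    exact ⟨hOU (hBO hu.1), hu.2⟩
  · rw [Fintype.linearIndependent_iff]
    intro v hv
    have h1 : fderiv ℝ F u v = 0 := by rw [map_eq_sum_stdb]; exact hv
    have h2 := congrArg projBase h1
    rw [hdF u hu.1, projBase_snoc] at h2
    exact fun i => congrFun h2 i
  · simp only [N, F, snocL_apply, minner_prodMet, projBase_snoc, Fin.snoc_last, minner_smul_left,
      minner_smul_right]
    have := hθ2 u hu.1
    simp only [q] at this
    linarith
  · simp only [N, hdF u hu.1]
    simp only [F, snocL_apply, minner_prodMet, projBase_snoc, Fin.snoc_last, minner_smul_left]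
    have := (hθ0 u hu.1).ne'
    field_simp
    ring
  · change covMap (prodMet g) F N u (stdb n a) = _
    have hub := hu.1
    have hNu : DifferentiableAt ℝ N u :=
      (hN.contDiffAt (hB.mem_nhds hub)).differentiableAt (by simp)
    have hprojF : (fun y => projBase (F y)) = fun y => y := by
      funext y
      simp [F, snocL_apply]
    have hprojN : (fun y => projBase (N y)) = fun y => c • X y := by
      funext y
      simp [N, snocL_apply]
    have hpu : projBase (F u) ∈ U := by
      rw [show projBase (F u) = u from congrFun hprojF u]
      exact hOU (hBO hub)
    refine ext_projBase ?_ ?_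
    · rw [projBase_covMap_prodMet hU hg hpu (hFd u hub).differentiableAt hNu, hprojF, hprojN]
      have e1 := hc u (hBO hub) (stdb n a)
      rw [covD_eq_covMap] at e1
      rw [covMap_const_smul (hXd u hub), hdF u hub]
      refine (congrArg (c • ·) e1).trans ?_
      ext i
      simp [projBase, mul_assoc]
    · rw [covMap_prodMet_last hU hg hpu hNu]
      have hlast : (fun y => N y (Fin.last n)) = θ := by
        funext y
        simp [N, snocL_apply]
      have hqd : HasFDerivAt q _ u :=
        ((hq.contDiffAt (hO.mem_nhds (hBO hub))).differentiableAt (by simp)).hasFDerivAt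
      have hθd : HasFDerivAt θ _ u := ((hqd.const_mul (c ^ 2)).const_sub 1).sqrt (hBT u hub).ne'
      have hqv : fderiv ℝ q u (stdb n a) = 2 * lam u * minner g u (X u) (stdb n a) :=
        fderiv_minner_self_of_covD_eq_smul hU hg (hOU (hBO hub)) (hXd u hub) (hc u (hBO hub)) _
      rw [hlast, hθd.fderiv]
      have e0 := (hθ0 u hub).ne'
      simp only [Pi.smul_apply, hdF u hub, Fin.snoc_last, smul_apply, neg_apply, hqv, smul_eq_mul]
      change 1 / (2 * θ u) * _ = _
      field_simp
  · simpa [hφp] using ht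
  · simp only [F, snocL_apply, hφp, add_zero]
  · simpa [N, snocL_apply] using (hθ0 p hpB).ne'
  · by_contra! hcon
    have h0 : (-c / θ p) • minnerL g p (X p) = 0 := clm_eq_of_stdb fun a => by
      have := hcon a
      simp only [hdF p hpB, Fin.snoc_last] at this
      simpa using this
    have h1 := congrArg (fun A : Pt n →L[ℝ] ℝ => A (X p)) h0
    have h2 : -c / θ p * q p = 0 := h1
    exact mul_ne_zero (div_ne_zero (neg_ne_zero.2 hc0.ne') (hθ0 p hpB).ne') hqp.ne' h2

end Graph

section Warped

variable {m n : ℕ} {g : Met n}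

theorem covMap_smul {F X : Pt m → Pt n} {s : Pt m → ℝ} {u : Pt m} (hs : DifferentiableAt ℝ s u)
    (hX : DifferentiableAt ℝ X u) (v : Pt m) :
    covMap g F (fun y => s y • X y) u v = fderiv ℝ s u v • X u + s u • covMap g F X u v := by
  have h : HasFDerivAt (fun y => s y • X y) _ u := hs.hasFDerivAt.smul hX.hasFDerivAt
  rw [covMap_eq hX, covMap_eq h.differentiableAt, h.fderiv, chrisV_smul_right, smul_add]
  simp
  abel

theorem contDiffOn_fderiv_apply {E F : Type*} [NormedAddCommGroup E] [NormedSpace ℝ E]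
    [NormedAddCommGroup F] [NormedSpace ℝ F] {f : E → F} {O : Set E} (hO : IsOpen O)
    (hf : ContDiffOn ℝ ∞ f O) (v : E) : ContDiffOn ℝ ∞ (fun y => fderiv ℝ f y v) O :=
  (hf.fderiv_of_isOpen (m := ∞) hO (by simp)).clm_apply contDiffOn_const

theorem differentiableAt_of_contDiffOn {E F : Type*} [NormedAddCommGroup E] [NormedSpace ℝ E]
    [NormedAddCommGroup F] [NormedSpace ℝ F] {f : E → F} {O : Set E} (hO : IsOpen O)
    (hf : ContDiffOn ℝ ∞ f O) {x : E} (hx : x ∈ O) : DifferentiableAt ℝ f x :=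
  (hf.contDiffAt (hO.mem_nhds hx)).differentiableAt (by simp)

/-- The Koszul formula for coordinate fields along a map. -/
theorem minner_covMap_fderiv {U : Set (Pt n)} (hU : IsOpen U) (hg : IsMetricOn U g)
    {Φ : Pt n → Pt n} {W : Set (Pt n)} (hW : IsOpen W) (hΦ : ContDiffOn ℝ ∞ Φ W)
    {w : Pt n} (hw : w ∈ W) (hwU : Φ w ∈ U) (a b c : Fin n) :
    minner g (Φ w) (covMap g Φ (fun y => fderiv ℝ Φ y (stdb n b)) w (stdb n a))
        (fderiv ℝ Φ w (stdb n c)) =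
      1 / 2 * (fderiv ℝ (fun y => pullMet g Φ y b c) w (stdb n a) +
        fderiv ℝ (fun y => pullMet g Φ y a c) w (stdb n b) -
        fderiv ℝ (fun y => pullMet g Φ y a b) w (stdb n c)) := by
  have hd : ∀ i, DifferentiableAt ℝ (fun y => fderiv ℝ Φ y (stdb n i)) w := fun i =>
    differentiableAt_of_contDiffOn hW (contDiffOn_fderiv_apply hW hΦ _) hw
  have hΦw := hΦ.contDiffAt (hW.mem_nhds hw)
  have key : ∀ i j k, fderiv ℝ (fun y => pullMet g Φ y j k) w (stdb n i) = _ := fun i j k =>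
    fderiv_minner_eq_covMap hU hg hwU (hΦw.differentiableAt (by simp)) (hd j) (hd k) (stdb n i)
  rw [key, key, key, covMap_fderiv_comm hg.2.1 hΦw (stdb n b) (stdb n a),
    covMap_fderiv_comm hg.2.1 hΦw (stdb n c) (stdb n a),
    covMap_fderiv_comm hg.2.1 hΦw (stdb n c) (stdb n b),
    minner_comm hg.2.1 (fderiv ℝ Φ w (stdb n b)), minner_comm hg.2.1 (fderiv ℝ Φ w (stdb n a))]
  ring

/-- A vector orthogonal to the range of a surjective map vanishes. -/
theorem eq_of_minner_eq {U : Set (Pt n)} (hg : IsMetricOn U g) {x : Pt n} (hx : x ∈ U)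
    {L : Pt n →L[ℝ] Pt n} (hL : Function.Surjective L) {v w : Pt n}
    (h : ∀ b, minner g x v (L (stdb n b)) = minner g x w (L (stdb n b))) : v = w := by
  have h1 : (minnerL g x v).comp L = (minnerL g x w).comp L := clm_eq_of_stdb fun b => h b
  obtain ⟨z, hz⟩ := hL (v - w)
  have h2 : minner g x v (L z) = minner g x w (L z) :=
    congrArg (fun A : Pt n →L[ℝ] ℝ => A z) h1
  refine sub_eq_zero.1 (eq_zero_of_minner_eq_zero hg hx ?_)
  rw [minner_sub_left, ← hz, h2, sub_self]

theorem fderiv_comp_apply_zero_stdb {f : ℝ → ℝ} {w : Pt (n + 1)}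
    (hf : DifferentiableAt ℝ f (w 0)) (a : Fin (n + 1)) :
    fderiv ℝ (fun y : Pt (n + 1) => f (y 0)) w (stdb (n + 1) a) =
      if a = 0 then deriv f (w 0) else 0 := by
  have h1 : HasFDerivAt (fun y : Pt (n + 1) => f (y 0)) _ w :=
    hf.hasDerivAt.comp_hasFDerivAt w (hasFDerivAt_apply (𝕜 := ℝ) 0 w)
  rw [h1.fderiv]
  by_cases ha : a = 0 <;> simp [stdb, ha, eq_comm]

/-- A warped product carries the closed conformal field `f ∂ₜ`. -/
theorem hasClosedConformalField_of_locallyWarpedAt {g : Met (n + 1)} {U : Set (Pt (n + 1))}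
    (hU : IsOpen U) (hg : IsMetricOn U g) {p : Pt (n + 1)} (h : LocallyWarpedAt U g p) :
    HasClosedConformalField U g p := by
  obtain ⟨W, Φ, Ψ, hW, hΦ, hΦU, ho, hp, hΨ, hl, f, hf, hf0, hform⟩ := h
  have hd : ∀ i, ContDiffOn ℝ ∞ (fun y => fderiv ℝ Φ y (stdb (n + 1) i)) W := fun i =>
    contDiffOn_fderiv_apply hW hΦ _
  let Y : Pt (n + 1) → Pt (n + 1) := fun y => f (y 0) • fderiv ℝ Φ y (stdb (n + 1) 0)
  have hf0c : ContDiff ℝ ∞ fun y : Pt (n + 1) => f (y 0) := hf.comp (contDiff_apply ℝ ℝ 0)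
  have hY : ContDiffOn ℝ ∞ Y W := hf0c.contDiffOn.smul (hd 0)
  have hmaps : MapsTo Ψ (Φ '' W) W := by
    rintro _ ⟨w, hw, rfl⟩
    rwa [hl w hw]
  have hX : ContDiffOn ℝ ∞ (fun q => Y (Ψ q)) (Φ '' W) := hY.comp hΨ hmaps
  have hf' : ∀ (w : Pt (n + 1)) (a : Fin (n + 1)),
      fderiv ℝ (fun y : Pt (n + 1) => f (y 0)) w (stdb (n + 1) a) =
        if a = 0 then deriv f (w 0) else 0 := fun w a =>
    fderiv_comp_apply_zero_stdb (hf.differentiable (by simp) (w 0)) a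
  have hconst : ∀ w ∈ W, ∀ i, pullMet g Φ w 0 i = if i = 0 then 1 else 0 := by
    intro w hw i
    by_cases hi : i = 0
    · simp [hi, (hform w hw).1]
    · simp [hi, ((hform w hw).2.1 i hi).1]
  have hconst' : ∀ w i, pullMet g Φ w i 0 = pullMet g Φ w 0 i := fun w i =>
    minner_comm hg.2.1 _ _
  have hdconst : ∀ w ∈ W, ∀ i v, fderiv ℝ (fun y => pullMet g Φ y 0 i) w v = 0 := by
    intro w hw i v
    rw [(Filter.eventuallyEq_of_mem (hW.mem_nhds hw) fun y hy => hconst y hy i :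
      (fun y => pullMet g Φ y 0 i) =ᶠ[𝓝 w] fun _ => if i = 0 then 1 else 0).fderiv_eq]
    simp
  have hdwarp : ∀ w ∈ W, ∀ i j, i ≠ 0 → j ≠ 0 →
      f (w 0) * fderiv ℝ (fun y => pullMet g Φ y i j) w (stdb (n + 1) 0) =
        2 * deriv f (w 0) * pullMet g Φ w i j := by
    intro w hw i j hi hj
    have h0 := (hform w hw).2.2 i j hi hj
    have hgd : DifferentiableAt ℝ (fun y => pullMet g Φ y i j) w :=
      differentiableAt_of_contDiffOn hW (contDiffOn_minner hg hΦ hΦU (hd i) (hd j)) hw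
    have hfd : DifferentiableAt ℝ (fun y : Pt (n + 1) => f (y 0)) w :=
      hf0c.differentiable (by simp) w
    have hfw := (hf0 (w 0)).ne'
    have h2 : DifferentiableAt ℝ (fun y => pullMet g Φ y i j / f (y 0) ^ 2) w :=
      hgd.fun_mul ((hfd.fun_pow 2).fun_inv (pow_ne_zero 2 hfw))
    have h3 : HasFDerivAt (fun y => pullMet g Φ y i j / f (y 0) ^ 2 * f (y 0) ^ 2) _ w :=
      h2.hasFDerivAt.mul (hfd.hasFDerivAt.pow 2)
    rw [show (fun y => pullMet g Φ y i j) = fun y => pullMet g Φ y i j / f (y 0) ^ 2 * f (y 0) ^ 2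
      from funext fun y => (div_mul_cancel₀ _ (pow_ne_zero 2 (hf0 (y 0)).ne')).symm, h3.fderiv]
    simp [hf', h0]
    field_simp
  have hcov : ∀ w ∈ W, ∀ a, covMap g Φ Y w (stdb (n + 1) a) =
      deriv f (w 0) • fderiv ℝ Φ w (stdb (n + 1) a) := by
    intro w hw a
    refine eq_of_minner_eq hg (hΦU hw) (surjective_fderiv_of_leftInverse hW hΦ ho hΨ hl hw)
      fun b => ?_
    rw [covMap_smul (hf0c.differentiable (by simp) w) (differentiableAt_of_contDiffOn hW (hd 0) hw),
      minner_add_left, minner_smul_left, minner_smul_left, minner_smul_left,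
      minner_covMap_fderiv hU hg hW hΦ hw (hΦU hw), hf', hdconst w hw]
    have e1 : fderiv ℝ (fun y => pullMet g Φ y a 0) w (stdb (n + 1) b) = 0 := by
      simp only [hconst', hdconst w hw]
    rw [e1]
    change _ * pullMet g Φ w 0 b + _ = _ * pullMet g Φ w a b
    by_cases ha : a = 0
    · subst ha
      simp [hdconst w hw]
    · by_cases hb : b = 0
      · subst hb
        simp [ha, hconst', hdconst w hw, hconst w hw]
      · have := hdwarp w hw a b ha hb
        rw [if_neg ha]
        linarith
  obtain ⟨w₀, hw₀, rfl⟩ := hp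
  refine ⟨Φ '' W, ho, ⟨w₀, hw₀, rfl⟩, ?_, fun q => Y (Ψ q), fun q => deriv f (Ψ q 0), hX, ?_, ?_⟩
  · rintro _ ⟨w, hw, rfl⟩
    exact hΦU hw
  · rintro _ ⟨w, hw, rfl⟩ v
    obtain ⟨z, rfl⟩ := surjective_fderiv_of_leftInverse hW hΦ ho hΨ hl hw v
    rw [← covMap_comp (differentiableAt_of_contDiffOn hW hΦ hw)
      (differentiableAt_of_contDiffOn ho hX ⟨w, hw, rfl⟩)]
    beta_reduce
    rw [hl w hw, covMap_congr (W' := Y) (Filter.eventuallyEq_of_mem (hW.mem_nhds hw) fun y hy => by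
      simp only [hl y hy])]
    have h1 : covMapL g Φ Y w = deriv f (w 0) • fderiv ℝ Φ w :=
      clm_eq_of_stdb fun a => hcov w hw a
    exact congrArg (fun A : Pt (n + 1) →L[ℝ] Pt (n + 1) => A z) h1
  · beta_reduce
    rw [hl w₀ hw₀]
    refine smul_ne_zero (hf0 _).ne' fun h0 => ?_
    have h1 := (hform w₀ hw₀).1
    rw [pullMet, h0, minner_zero_left] at h1
    exact zero_ne_one h1

end Warped

section AdaptedCoordinates

variable {n : ℕ}

theorem eq_of_forall_hasDerivAt_zero {f : ℝ → ℝ} (h : ∀ t ∈ Icc (0 : ℝ) 1, HasDerivAt f 0 t) :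
    f 1 = f 0 :=
  constant_of_has_deriv_right_zero (fun t ht => (h t ht).continuousAt.continuousWithinAt)
    (fun t ht => (h t (Ico_subset_Icc_self ht)).hasDerivWithinAt) 1 (by simp)

/-- Coordinates in which the first coordinate is a given function `A` and the first coordinate
field is a given field `Y` with `dA(Y) = 1`. -/
theorem exists_adapted_coordinates {p : Pt (n + 1)} {B : Set (Pt (n + 1))} (hB : IsOpen B)
    (hp : p ∈ B) {Y : Pt (n + 1) → Pt (n + 1)} (hY : ContDiff ℝ ∞ Y) {A : Pt (n + 1) → ℝ}
    (hA : ContDiffOn ℝ ∞ A B) (hAp : A p = 0) (hAY : ∀ x ∈ B, fderiv ℝ A x (Y x) = 1) :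
    ∃ (D : Set (Pt (n + 1))) (Φ : Pt (n + 1) → Pt (n + 1)), IsOpen D ∧ 0 ∈ D ∧
      ContDiffOn ℝ ∞ Φ D ∧ MapsTo Φ D B ∧ Φ 0 = p ∧
      (∀ y ∈ D, ∀ v, fderiv ℝ A (Φ y) (fderiv ℝ Φ y v) = v 0) ∧
      (∀ y ∈ D, fderiv ℝ Φ y (stdb (n + 1) 0) = Y (Φ y)) ∧
      ∀ v, fderiv ℝ Φ 0 v = 0 → v = 0 := by
  let e := stdb (n + 1) 0
  have he0 : e 0 = 1 := by simp [e, stdb]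
  have he : e ≠ 0 := fun h => by simp [h] at he0
  have hYp : Y p ≠ 0 := fun h => by simpa [h] using hAY p hp
  obtain ⟨M, hM⟩ := SeparatingDual.exists_continuousLinearEquiv_apply_eq (R := ℝ) he hYp
  let L : Pt (n + 1) →L[ℝ] Pt (n + 1) := (M : Pt (n + 1) →L[ℝ] Pt (n + 1)).comp
    (ContinuousLinearMap.id ℝ _ - (ContinuousLinearMap.proj (R := ℝ) 0).smulRight e)
  have hL : ∀ y, L y = M (y - y 0 • e) := fun y => rfl
  have hLe : L e = 0 := by rw [hL, he0, one_smul, sub_self, map_zero]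
  obtain ⟨fl, O, hO, hpO, hfl, hfl0, hflY⟩ := exists_smooth_local_flow hY p
  have hfp : fl (0, p) = p := hfl0 (0, p) hpO
  obtain ⟨δ, hδ, hδO⟩ := Metric.isOpen_iff.1 (hfl.continuousOn.isOpen_inter_preimage hO hB) (0, p)
    ⟨hpO, by rwa [mem_preimage, hfp]⟩
  let Q := Metric.ball ((0 : ℝ), p) δ
  have hQO : Q ⊆ O := fun z hz => (hδO hz).1
  have hQB : ∀ z ∈ Q, fl z ∈ B := fun z hz => (hδO hz).2
  have hAfl : ∀ z ∈ Q, A (fl z) = A z.2 + z.1 := by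
    rintro ⟨s, x⟩ hz
    have hmem : ∀ t ∈ Icc (0 : ℝ) 1, (t * s, x) ∈ Q := by
      intro t ht
      rw [Metric.mem_ball, Prod.dist_eq, max_lt_iff] at hz ⊢
      refine ⟨lt_of_le_of_lt ?_ hz.1, hz.2⟩
      simp only [dist_zero_right, norm_mul, Real.norm_eq_abs, abs_of_nonneg ht.1]
      exact mul_le_of_le_one_left (abs_nonneg s) ht.2
    have h := eq_of_forall_hasDerivAt_zero (f := fun t => A (fl (t * s, x)) - t * s)
      fun t ht => by
        have hz' := hmem t ht
        have h1 : HasDerivAt (fun t : ℝ => t * s) s t := hasDerivAt_mul_const s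
        have h2 : HasDerivAt (fun t : ℝ => fl (t * s, x)) (s • Y (fl (t * s, x))) t :=
          HasDerivAt.scomp (g₁ := fun s => fl (s, x)) t (hflY _ (hQO hz')) h1
        have h3 := (differentiableAt_of_contDiffOn hB hA (hQB _ hz')).hasFDerivAt.comp_hasDerivAt
          t h2
        have h4 := h3.sub h1
        rwa [map_smul, hAY _ (hQB _ hz'), smul_eq_mul, mul_one, sub_self] at h4
    have h0 : fl (0, x) = x := hfl0 (s, x) (hQO hz)
    simp only [one_mul, zero_mul, h0, sub_zero] at h
    linarith
  let σ : Pt (n + 1) → Pt (n + 1) := fun y => p + L y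
  let τ : Pt (n + 1) → ℝ := fun y => y 0 - A (σ y)
  have hσ : ContDiff ℝ ∞ σ := contDiff_const.add L.contDiff
  have hσ0 : σ 0 = p := by simp [σ]
  have hτ : ContDiffOn ℝ ∞ τ (σ ⁻¹' B) :=
    (contDiff_apply ℝ ℝ 0).contDiffOn.sub (hA.comp hσ.contDiffOn fun y hy => hy)
  have hτ0 : τ 0 = 0 := by simp [τ, hσ0, hAp]
  have hS : IsOpen (σ ⁻¹' B) := hB.preimage hσ.continuous
  have hτσ : ContDiffOn ℝ ∞ (fun y => (τ y, σ y)) (σ ⁻¹' B) := hτ.prodMk hσ.contDiffOn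
  let D : Set (Pt (n + 1)) := σ ⁻¹' B ∩ (fun y => (τ y, σ y)) ⁻¹' Q
  have hD : IsOpen D := hτσ.continuousOn.isOpen_inter_preimage hS Metric.isOpen_ball
  have h0D : (0 : Pt (n + 1)) ∈ D := ⟨by rwa [mem_preimage, hσ0], by
    rw [mem_preimage, hσ0, hτ0]
    exact Metric.mem_ball_self hδ⟩
  let Φ : Pt (n + 1) → Pt (n + 1) := fun y => fl (τ y, σ y)
  have hΦ : ContDiffOn ℝ ∞ Φ D :=
    hfl.comp (hτσ.mono inter_subset_left) fun y hy => hQO hy.2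
  have hΦB : MapsTo Φ D B := fun y hy => hQB _ hy.2
  have hAΦ : ∀ y ∈ D, A (Φ y) = y 0 := by
    intro y hy
    refine (hAfl _ hy.2).trans ?_
    simp only [τ]
    ring
  have hdAΦ : ∀ y ∈ D, ∀ v, fderiv ℝ A (Φ y) (fderiv ℝ Φ y v) = v 0 := by
    intro y hy v
    have h1 : HasFDerivAt (fun y => A (Φ y)) _ y :=
      (differentiableAt_of_contDiffOn hB hA (hΦB hy)).hasFDerivAt.comp y
        (differentiableAt_of_contDiffOn hD hΦ hy).hasFDerivAt
    have h2 : HasFDerivAt (fun y => A (Φ y)) (ContinuousLinearMap.proj (R := ℝ) 0) y :=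
      (hasFDerivAt_apply (𝕜 := ℝ) (0 : Fin (n + 1)) y).congr_of_eventuallyEq
        (Filter.eventuallyEq_of_mem (hD.mem_nhds hy) hAΦ)
    exact congrArg (fun T : Pt (n + 1) →L[ℝ] ℝ => T v) (h1.unique h2)
  refine ⟨D, Φ, hD, h0D, hΦ, hΦB, by simp only [Φ, hτ0, hσ0, hfp], hdAΦ, fun y hy => ?_,
    fun v hv => ?_⟩
  · have h1 : HasDerivAt (fun s : ℝ => Φ (y + s • e)) (fderiv ℝ Φ y e) 0 := by
      have h2 : HasDerivAt (fun s : ℝ => y + s • e) e 0 := by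
        simpa using ((hasDerivAt_id (0 : ℝ)).smul_const e).const_add y
      refine HasFDerivAt.comp_hasDerivAt (l := Φ) (0 : ℝ) ?_ h2
      rw [zero_smul, add_zero]
      exact (differentiableAt_of_contDiffOn hD hΦ hy).hasFDerivAt
    have h3 : HasDerivAt (fun s : ℝ => fl (τ y + s, σ y)) (Y (Φ y)) 0 := by
      refine HasDerivAt.comp_const_add (f := fun s => fl (s, σ y)) (τ y) 0 ?_
      rw [add_zero]
      exact hflY _ (hQO hy.2)
    have h4 : (fun s : ℝ => Φ (y + s • e)) = fun s => fl (τ y + s, σ y) := by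
      funext s
      have hσs : σ (y + s • e) = σ y := by simp [σ, hLe]
      simp only [Φ, τ, hσs, Pi.add_apply, Pi.smul_apply, he0, smul_eq_mul, mul_one]
      congr 2
      ring
    rw [h4] at h1
    exact h1.unique h3
  · have hv0 : v 0 = 0 := by
      rw [← hdAΦ 0 h0D v, hv, map_zero]
    have hfd : HasFDerivAt fl (fderiv ℝ fl (0, p)) (0, p) :=
      (differentiableAt_of_contDiffOn hO hfl hpO).hasFDerivAt
    have hf1 : fderiv ℝ fl (0, p) (1, 0) = Y p := by
      have h1 : HasDerivAt (fun s : ℝ => (s, p)) ((1 : ℝ), (0 : Pt (n + 1))) 0 :=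
        (hasDerivAt_id (0 : ℝ)).prodMk (hasDerivAt_const _ _)
      have h2 := hflY _ hpO
      rw [hfp] at h2
      exact (hfd.comp_hasDerivAt (0 : ℝ) h1).unique h2
    have hf2 : ∀ w, fderiv ℝ fl (0, p) (0, w) = w := by
      intro w
      have h1 : HasFDerivAt (fun x : Pt (n + 1) => ((0 : ℝ), x))
          (ContinuousLinearMap.inr ℝ ℝ (Pt (n + 1))) p := hasFDerivAt_prodMk_right _ _
      have h2 : HasFDerivAt (fun x : Pt (n + 1) => fl (0, x)) (ContinuousLinearMap.id ℝ _) p := by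
        refine (hasFDerivAt_id p).congr_of_eventuallyEq (Filter.eventuallyEq_of_mem
          (Filter.inter_mem (hO.preimage (f := fun x : Pt (n + 1) => ((0 : ℝ), x))
            (by fun_prop) |>.mem_nhds hpO) Filter.univ_mem) fun x hx => hfl0 _ hx.1)
      exact congrArg (fun T : Pt (n + 1) →L[ℝ] Pt (n + 1) => T w) ((hfd.comp p h1).unique h2)
    have hσd : HasFDerivAt σ L 0 := L.hasFDerivAt.const_add p
    have hτd := differentiableAt_of_contDiffOn hS hτ h0D.1
    have hΦd : HasFDerivAt Φ _ 0 := HasFDerivAt.comp (g := fl) 0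
      (by rw [hτ0, hσ0]; exact hfd) (hτd.hasFDerivAt.prodMk hσd)
    rw [hΦd.fderiv] at hv
    have hv : fderiv ℝ fl (0, p) (fderiv ℝ τ 0 v, L v) = 0 := hv
    rw [show (fderiv ℝ τ 0 v, L v) =
      (fderiv ℝ τ 0 v) • ((1 : ℝ), (0 : Pt (n + 1))) + ((0 : ℝ), L v) by simp, map_add, map_smul,
      hf1, hf2, hL, hv0, zero_smul, sub_zero, ← hM, ← map_smul, ← map_add] at hv
    have h5 := (map_eq_zero_iff M M.injective).1 hv
    have h6 := congrFun h5 0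
    simp only [Pi.add_apply, Pi.smul_apply, he0, hv0, smul_eq_mul, mul_one, add_zero,
      Pi.zero_apply] at h6
    rwa [h6, zero_smul, zero_add] at h5

end AdaptedCoordinates

section Converse

variable {n : ℕ}

/-- Near a point, a positive smooth function on an interval extends to a positive smooth function
on the line. -/
theorem exists_contDiff_pos_eventuallyEq {f : ℝ → ℝ} {O : Set ℝ} (hO : IsOpen O)
    (hf : ContDiffOn ℝ ∞ f O) (hf0 : ∀ s ∈ O, 0 < f s) {a : ℝ} (ha : a ∈ O) :
    ∃ h : ℝ → ℝ, ContDiff ℝ ∞ h ∧ (∀ s, 0 < h s) ∧ h =ᶠ[𝓝 a] f := by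
  obtain ⟨l, hl, hlf⟩ := exists_contDiff_eventuallyEq hO
    (hf.log fun s hs => (hf0 s hs).ne') ha
  refine ⟨fun s => Real.exp (l s), hl.exp, fun s => Real.exp_pos _, ?_⟩
  filter_upwards [hlf, hO.mem_nhds ha] with s hs hsO
  rw [hs, Real.exp_log (hf0 s hsO)]

/-- A closed conformal field without zeros splits the metric as a warped product. -/
theorem locallyWarpedAt_of_hasClosedConformalField {g : Met (n + 1)} {U : Set (Pt (n + 1))}
    (hU : IsOpen U) (hg : IsMetricOn U g) {p : Pt (n + 1)} (h : HasClosedConformalField U g p) :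
    LocallyWarpedAt U g p := by
  obtain ⟨O, hO, hpO, hOU, X, lam, hX, hc, hXp⟩ := h
  let q : Pt (n + 1) → ℝ := fun x => minner g x (X x) (X x)
  have hq : ContDiffOn ℝ ∞ q O := contDiffOn_minner (F := fun x => x) hg contDiffOn_id hOU hX hX
  have hqp : 0 < q p := hg.2.2 p (hOU hpO) _ hXp
  let O' := O ∩ q ⁻¹' Ioi 0
  have hO' : IsOpen O' := hq.continuousOn.isOpen_inter_preimage hO isOpen_Ioi
  let ρ : Pt (n + 1) → ℝ := fun x => √(q x)
  have hρ0 : ∀ x ∈ O', 0 < ρ x := fun x hx => Real.sqrt_pos.2 hx.2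
  have hρ2 : ∀ x ∈ O', ρ x * ρ x = q x := fun x hx => Real.mul_self_sqrt (le_of_lt hx.2)
  have hρ : ContDiffOn ℝ ∞ ρ O' := (hq.mono inter_subset_left).sqrt fun x hx => hx.2.ne'
  obtain ⟨Y, hY, hYX⟩ := exists_contDiff_eventuallyEq hO'
    ((hρ.inv fun x hx => (hρ0 x hx).ne').smul (hX.mono inter_subset_left)) ⟨hpO, hqp⟩
  obtain ⟨r, hr, hrO⟩ := Metric.mem_nhds_iff.1 (Filter.inter_mem (hO'.mem_nhds ⟨hpO, hqp⟩) hYX)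
  let B := Metric.ball p r
  have hB : IsOpen B := Metric.isOpen_ball
  have hpB : p ∈ B := Metric.mem_ball_self hr
  have hBO' : B ⊆ O' := fun x hx => (hrO hx).1
  have hBO : B ⊆ O := fun x hx => (hBO' hx).1
  have hYB : ∀ x ∈ B, Y x = (ρ x)⁻¹ • X x := fun x hx => (hrO hx).2
  have hXY : ∀ x ∈ B, X x = ρ x • Y x := fun x hx => by
    rw [hYB x hx, smul_inv_smul₀ (hρ0 x (hBO' hx)).ne']
  obtain ⟨A, hA, hAp, hdA⟩ := exists_potential (k := fun s => 1 / √s) (T := Ioi 0) hU hg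
    (hBO.trans hOU) (hX.mono hBO) (fun x hx => hc x (hBO hx)) isOpen_Ioi (by
      refine contDiffOn_const.div (ContDiffOn.sqrt (by fun_prop) fun s hs => ?_) fun s hs => ?_
      · exact ne_of_gt hs
      · exact (Real.sqrt_pos.2 hs).ne') fun x hx => (hBO' hx).2
  have hdAY : ∀ x ∈ B, ∀ v, fderiv ℝ A x v = minner g x (Y x) v := by
    intro x hx v
    rw [(hdA x hx).fderiv, hYB x hx, minner_smul_left]
    simp [ρ, q]
  have hYY : ∀ x ∈ B, minner g x (Y x) (Y x) = 1 := by
    intro x hx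
    have h1 := hρ2 x (hBO' hx)
    have h2 := (hρ0 x (hBO' hx)).ne'
    rw [hYB x hx, minner_smul_left, minner_smul_right]
    change (ρ x)⁻¹ * ((ρ x)⁻¹ * q x) = 1
    rw [← h1]
    field_simp
  have hdρ : ∀ x ∈ B, ∀ v, fderiv ℝ ρ x v = lam x * minner g x (Y x) v := by
    intro x hx v
    have hqd : HasFDerivAt q _ x := (differentiableAt_of_contDiffOn hO hq (hBO hx)).hasFDerivAt
    have hρd : HasFDerivAt ρ _ x := hqd.sqrt (ne_of_gt (hBO' hx).2)
    have hqv : fderiv ℝ q x v = 2 * lam x * minner g x (X x) v :=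
      fderiv_minner_self_of_covD_eq_smul hU hg (hOU (hBO hx))
        (differentiableAt_of_contDiffOn hO hX (hBO hx)) (hc x (hBO hx)) v
    have h2 := (hρ0 x (hBO' hx)).ne'
    rw [hρd.fderiv, smul_apply, hqv, hYB x hx, minner_smul_left]
    change 1 / (2 * ρ x) * _ = _
    field_simp
  obtain ⟨D, Φ, hD, h0D, hΦ, hΦB, hΦ0, hdAΦ, hdΦ0, hinj⟩ := exists_adapted_coordinates hB hpB hY hA
    hAp fun x hx => by rw [hdAY x hx, hYY x hx]
  have hYΦ : ∀ y ∈ D, ∀ v, minner g (Φ y) (Y (Φ y)) (fderiv ℝ Φ y v) = v 0 := fun y hy v => by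
    rw [← hdAY _ (hΦB hy), hdAΦ y hy]
  have hρΦ : ContDiffOn ℝ ∞ (fun y => ρ (Φ y)) D :=
    hρ.comp hΦ fun y hy => hBO' (hΦB hy)
  have hdρΦ : ∀ y ∈ D, ∀ v, fderiv ℝ (fun y => ρ (Φ y)) y v = lam (Φ y) * v 0 := by
    intro y hy v
    have h1 : HasFDerivAt (fun y => ρ (Φ y)) _ y :=
      (differentiableAt_of_contDiffOn hO' hρ (hBO' (hΦB hy))).hasFDerivAt.comp y
        (differentiableAt_of_contDiffOn hD hΦ hy).hasFDerivAt
    rw [h1.fderiv, ContinuousLinearMap.comp_apply, hdρ _ (hΦB hy), hYΦ y hy]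
  obtain ⟨r₁, hr₁, hr₁D⟩ := Metric.isOpen_iff.1 hD 0 h0D
  let ι : ℝ → Pt (n + 1) := fun s => s • stdb (n + 1) 0
  have hι : ContDiff ℝ ∞ ι := contDiff_id.smul contDiff_const
  have hball : ∀ y ∈ Metric.ball (0 : Pt (n + 1)) r₁, ∀ t ∈ Icc (0 : ℝ) 1,
      ι (y 0) + t • (y - ι (y 0)) ∈ Metric.ball (0 : Pt (n + 1)) r₁ := by
    intro y hy t ht
    rw [mem_ball_zero_iff, pi_norm_lt_iff hr₁] at hy ⊢
    intro i
    by_cases hi : i = 0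
    · subst hi
      simpa [ι, stdb] using hy 0
    · simp only [ι, stdb, Pi.add_apply, Pi.smul_apply, Pi.sub_apply, Pi.single_eq_of_ne hi,
        smul_eq_mul, mul_zero, zero_add, sub_zero, norm_mul, Real.norm_eq_abs, abs_of_nonneg ht.1]
      exact lt_of_le_of_lt (mul_le_of_le_one_left (abs_nonneg _) ht.2) (hy i)
  have hline : ∀ y ∈ Metric.ball (0 : Pt (n + 1)) r₁, ρ (Φ y) = ρ (Φ (ι (y 0))) := by
    intro y hy
    have h := eq_of_forall_hasDerivAt_zero (f := fun t => ρ (Φ (ι (y 0) + t • (y - ι (y 0)))))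
      fun t ht => by
        have hz := hr₁D (hball y hy t ht)
        have h1 : HasDerivAt (fun t : ℝ => ι (y 0) + t • (y - ι (y 0))) (y - ι (y 0)) t := by
          simpa using ((hasDerivAt_id t).smul_const (y - ι (y 0))).const_add (ι (y 0))
        have h2 := HasFDerivAt.comp_hasDerivAt (l := fun y => ρ (Φ y)) t
          (differentiableAt_of_contDiffOn hD hρΦ hz).hasFDerivAt h1
        rw [hdρΦ _ hz, show (y - ι (y 0)) 0 = 0 by simp [ι, stdb], mul_zero] at h2
        exact h2
    simpa using h
  obtain ⟨f, hf, hf0, hfρ⟩ := exists_contDiff_pos_eventuallyEq (f := fun s => ρ (Φ (ι s)))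
    (hD.preimage hι.continuous) (hρΦ.comp hι.contDiffOn fun s hs => hs)
    (fun s hs => hρ0 _ (hBO' (hΦB hs))) (a := 0) (by simpa [ι] using h0D)
  obtain ⟨r₂, hr₂, hr₂f⟩ := Metric.mem_nhds_iff.1 hfρ
  let D' := Metric.ball (0 : Pt (n + 1)) (min r₁ r₂)
  have hD'1 : D' ⊆ Metric.ball 0 r₁ := Metric.ball_subset_ball (min_le_left _ _)
  have hD'D : D' ⊆ D := hD'1.trans hr₁D
  have hρf : ∀ y ∈ D', ρ (Φ y) = f (y 0) := by
    intro y hy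
    rw [hline y (hD'1 hy)]
    refine (hr₂f ?_ : f (y 0) = ρ (Φ (ι (y 0)))).symm
    rw [mem_ball_zero_iff]
    exact lt_of_le_of_lt (norm_le_pi_norm y 0)
      (lt_of_lt_of_le (mem_ball_zero_iff.1 hy) (min_le_right _ _))
  obtain ⟨r₃, hr₃, hr₃D, ho, Ψ, hΨ, hl⟩ := exists_ball_smooth_leftInverse_of_injective
    (Metric.isOpen_ball (x := (0 : Pt (n + 1))) (ε := min r₁ r₂)) (hΦ.mono hD'D)
    (Metric.mem_ball_self (lt_min hr₁ hr₂)) hinj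
  let W := Metric.ball (0 : Pt (n + 1)) r₃
  have hW : IsOpen W := Metric.isOpen_ball
  have hWD : W ⊆ D := hr₃D.trans hD'D
  have hΦU : MapsTo Φ W U := fun y hy => hOU (hBO (hΦB (hWD hy)))
  refine ⟨W, Φ, Ψ, hW, hΦ.mono hWD, hΦU, ho,
    ⟨0, Metric.mem_ball_self hr₃, hΦ0⟩, hΨ, hl, f, hf, hf0, fun y hy => ?_⟩
  have hyD := hWD hy
  have hcol : ∀ i, pullMet g Φ y 0 i = stdb (n + 1) i 0 := fun i => by
    rw [pullMet, hdΦ0 y hyD, hYΦ y hyD]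
  refine ⟨by simp [hcol, stdb], fun i hi => ?_, fun i j hi hj => ?_⟩
  · have h1 : pullMet g Φ y 0 i = 0 := by simp [hcol, stdb, hi.symm]
    exact ⟨h1, (minner_comm hg.2.1 _ _).trans h1⟩
  have hΦd := differentiableAt_of_contDiffOn hD hΦ hyD
  have hd : ∀ i, ContDiffOn ℝ ∞ (fun y => fderiv ℝ Φ y (stdb (n + 1) i)) D := fun i =>
    contDiffOn_fderiv_apply hD hΦ _
  have hdd : ∀ i, DifferentiableAt ℝ (fun y => fderiv ℝ Φ y (stdb (n + 1) i)) y := fun i =>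
    differentiableAt_of_contDiffOn hD (hd i) hyD
  have hfd : DifferentiableAt ℝ (fun y : Pt (n + 1) => f (y 0)) y :=
    (hf.comp (contDiff_apply ℝ ℝ 0)).differentiable (by simp) y
  have hfv : ∀ v, fderiv ℝ (fun y : Pt (n + 1) => f (y 0)) y v = lam (Φ y) * v 0 := fun v => by
    rw [← hdρΦ y hyD v, (Filter.eventuallyEq_of_mem (hW.mem_nhds hy) fun z hz => hρf z (hr₃D hz) :
      (fun y => ρ (Φ y)) =ᶠ[𝓝 y] fun y => f (y 0)).fderiv_eq]
  have hcov : ∀ i, i ≠ 0 →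
      f (y 0) • covMap g Φ (fun y => fderiv ℝ Φ y (stdb (n + 1) i)) y (stdb (n + 1) 0) =
        lam (Φ y) • fderiv ℝ Φ y (stdb (n + 1) i) := by
    intro i hi
    have h1 := covMap_smul (g := g) (F := Φ) hfd (hdd 0) (stdb (n + 1) i)
    rw [hfv, show stdb (n + 1) i 0 = 0 by simp [stdb, hi.symm], mul_zero, zero_smul, zero_add] at h1
    rw [covMap_fderiv_comm hg.2.1 (hΦ.contDiffAt (hD.mem_nhds hyD)), ← h1,
      ← hc _ (hBO (hΦB hyD)), ← covMap_comp hΦd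
        (differentiableAt_of_contDiffOn hO hX (hBO (hΦB hyD)))]
    refine covMap_congr (Filter.eventuallyEq_of_mem (hW.mem_nhds hy) fun z hz => ?_) _
    rw [hXY _ (hΦB (hWD hz)), hρf z (hr₃D hz), hdΦ0 z (hWD hz)]
  have hgd : DifferentiableAt ℝ (fun y => pullMet g Φ y i j) y :=
    differentiableAt_of_contDiffOn hD (contDiffOn_minner hg hΦ
      (fun y hy => hOU (hBO (hΦB hy))) (hd i) (hd j)) hyD
  have hg' : f (y 0) * fderiv ℝ (fun y => pullMet g Φ y i j) y (stdb (n + 1) 0) =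
      2 * lam (Φ y) * pullMet g Φ y i j := by
    have h1 : fderiv ℝ (fun y => pullMet g Φ y i j) y (stdb (n + 1) 0) = _ :=
      fderiv_minner_eq_covMap hU hg (hΦU hy) hΦd (hdd i) (hdd j) _
    rw [h1, mul_add, ← minner_smul_left, ← minner_smul_right, hcov i hi, hcov j hj,
      minner_smul_left, minner_smul_right, pullMet]
    ring
  have hfy := (hf0 (y 0)).ne'
  have h2 : DifferentiableAt ℝ (fun y => pullMet g Φ y i j / f (y 0) ^ 2) y :=
    hgd.fun_mul ((hfd.fun_pow 2).fun_inv (pow_ne_zero 2 hfy))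
  have h3 : HasFDerivAt (fun y => pullMet g Φ y i j / f (y 0) ^ 2 * f (y 0) ^ 2) _ y :=
    h2.hasFDerivAt.mul (hfd.hasFDerivAt.pow 2)
  rw [show (fun y => pullMet g Φ y i j) = fun y => pullMet g Φ y i j / f (y 0) ^ 2 * f (y 0) ^ 2
    from funext fun y => (div_mul_cancel₀ _ (pow_ne_zero 2 (hf0 (y 0)).ne')).symm, h3.fderiv] at hg'
  simp [hfv, show stdb (n + 1) 0 0 = 1 by simp [stdb]] at hg'
  field_simp at hg'
  have h4 : f (y 0) ^ 3 * fderiv ℝ (fun y => pullMet g Φ y i j / f (y 0) ^ 2) y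
      (stdb (n + 1) 0) = 0 := by linarith
  exact (mul_eq_zero.1 h4).resolve_left (pow_ne_zero 3 hfy)

end Converse

end

/-- Theorem 1, first part.  A Riemannian product `𝕄ⁿ × I` admits a
totally umbilical hypersurface which is neither vertical nor horizontal at a point
`(p,t)` if and only if `𝕄ⁿ` has, in a neighborhood of `p`, the structure of a warped
product of an interval of the Euclidean line with an `(n-1)`-dimensional manifold.
(Here `𝕄` has dimension `n+1` and the product `𝕄 × I` has dimension `n+2`.) -/
theorem statement3 {n : ℕ} (U₀ : Set (Pt (n+1))) (hU₀ : IsOpen U₀)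
    (I : Set ℝ) (hI : IsOpen I) (hIc : I.OrdConnected)
    (g₀ : Met (n+1)) (hg₀ : IsMetricOn U₀ g₀)
    (p : Pt (n+1)) (hp : p ∈ U₀) (t : ℝ) (ht : t ∈ I) :
    (∃ S : Hyp (n+1),
      S.IsRegular (prodDom U₀ I) (prodMet g₀) ∧
      S.TotallyUmbilical (prodMet g₀) ∧
      ∃ u₀ ∈ S.V, S.F u₀ = Fin.snoc p t ∧
        -- `Σ` is not vertical at `(p,t)` (the vertical field `ξ` is not tangent there):
        minner (prodMet g₀) (S.F u₀) (vert (n+1) (S.F u₀)) (S.N u₀) ≠ 0 ∧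
        -- `Σ` is not horizontal at `(p,t)` (`ξ` is not normal there):
        (∃ a : Fin (n+1),
          minner (prodMet g₀) (S.F u₀) (vert (n+1) (S.F u₀))
            (fderiv ℝ S.F u₀ (stdb (n+1) a)) ≠ 0))
    ↔ LocallyWarpedAt U₀ g₀ p := by
  constructor
  · rintro ⟨S, hS, humb, u₀, hu₀, hF, hv, a, ha⟩
    rw [minner_prodMet_vert] at hv ha
    have h := hasClosedConformalField_of_umbilical hU₀ hg₀ hS humb hu₀ hv ⟨a, ha⟩
    rw [hF, projBase_snoc] at h
    exact locallyWarpedAt_of_hasClosedConformalField hU₀ hg₀ h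
  · intro h
    obtain ⟨S, hS, humb, u₀, hu₀, hF, hv, a, ha⟩ := exists_umbilical_of_hasClosedConformalField
      hU₀ hg₀ hI ht (hasClosedConformalField_of_locallyWarpedAt hU₀ hg₀ h)
    refine ⟨S, hS, humb, u₀, hu₀, hF, ?_, a, ?_⟩
    · rwa [minner_prodMet_vert]
    · rwa [minner_prodMet_vert]
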